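/- Let D be a triangulated disk and let T be a subcomplex of the 1-skeleton of D with at least 2 vertices whose underlying graph is a tree (connected and acyclic). Then D collapses to T by a sequence of elementary collapses each of which is a (2,0) collapse or a (2,1) collapse. -/

import Mathlib

/-!
STATEMENT 9 (Lemma 13.3): a triangulated disk collapses to any tree in its
1-skeleton with at least 2 vertices using only (2,0) and (2,1) collapses.
-/

open scoped Classical

namespace PaperFormal

variable {V : Type*}

/-- `K` is a finite abstract simplicial complex. -/
def IsComplex (K : Set (Finset V)) : Prop :=
  (∀ σ ∈ K, σ ≠ ∅) ∧ ∀ σ ∈ K, ∀ τ : Finset V, τ ⊆ σ → τ ≠ ∅ → τ ∈ K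

/-- A facet is an inclusion-maximal face. -/
def IsFacet (K : Set (Finset V)) (σ : Finset V) : Prop :=
  σ ∈ K ∧ ∀ τ ∈ K, σ ⊆ τ → σ = τ

/-- An elementary collapse of `K` to `K'` through the free face `σ` with unique
containing facet `F`. -/
def ElemCollapseVia (K K' : Set (Finset V)) (σ F : Finset V) : Prop :=
  σ ∈ K ∧ ¬ IsFacet K σ ∧ IsFacet K F ∧ σ ⊆ F ∧
    (∀ G, IsFacet K G → σ ⊆ G → G = F) ∧
    K' = {τ ∈ K | ¬ σ ⊆ τ}

/-- An `(i,j)` collapse. -/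
def ElemCollapseIJ (K K' : Set (Finset V)) (i j : ℕ) : Prop :=
  ∃ σ F, ElemCollapseVia K K' σ F ∧ σ.card = j + 1 ∧ F.card = i + 1

/-- The underlying graph of a 1-dimensional complex `T`: vertices are the
elements whose singleton is a face of `T`, adjacency is given by the edges of
`T`. -/
def underlyingGraph (T : Set (Finset V)) :
    SimpleGraph {x : V // ({x} : Finset V) ∈ T} where
  Adj a b := ({(a : V), (b : V)} : Finset V) ∈ T ∧ (a : V) ≠ (b : V)
  symm := by
    constructor
    intro a b h
    refine ⟨?_, h.2.symm⟩
    rw [Finset.pair_comm]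
    exact h.1
  loopless := by
    constructor
    intro a h
    exact h.2 rfl

/-- The polyhedron of a collection of geometric faces. -/
def poly {N : ℕ} (S : Set (Finset (EuclideanSpace ℝ (Fin N)))) :
    Set (EuclideanSpace ℝ (Fin N)) :=
  ⋃ σ ∈ S, convexHull ℝ (σ : Set (EuclideanSpace ℝ (Fin N)))

/-- `S` is homeomorphic to the closed `d`-dimensional ball. -/
def IsBallSet {N : ℕ} (d : ℕ) (S : Set (EuclideanSpace ℝ (Fin N))) : Prop :=
  Nonempty (↥S ≃ₜ ↥(Metric.closedBall (0 : EuclideanSpace ℝ (Fin d)) 1))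

/-! ### Invariance of domain in the plane -/

/-- A nowhere vanishing function which is homotopic through nowhere vanishing functions to a
square of a continuous function is itself such a square. -/
lemma exists_sq_eq_of_homotopy {A : Type*} [TopologicalSpace A] (H : C(unitInterval × A, ℂ))
    (hH : ∀ p, H p ≠ 0) (h0 : ∃ g : C(A, ℂ), ∀ a, g a ^ 2 = H (0, a)) :
    ∃ g : C(A, ℂ), ∀ a, g a ^ 2 = H (1, a) := by
  obtain ⟨g, hg⟩ := h0
  have cov := Complex.isCoveringMapOn_exp.isCoveringMap_restrictPreimage
  let H' : C(unitInterval × A, ({0}ᶜ : Set ℂ)) :=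
    ⟨fun p => ⟨H p / H (0, p.2), by simp [hH]⟩,
      Continuous.subtype_mk (H.continuous.div (by fun_prop) fun p => hH _) fun p => by simp [hH]⟩
  let f : C(A, Complex.exp ⁻¹' ({0}ᶜ : Set ℂ)) := ⟨fun _ => ⟨0, by simp⟩, continuous_const⟩
  have H0 : ∀ a, H' (0, a) = Set.restrictPreimage {0}ᶜ Complex.exp (f a) := by
    intro a
    ext
    simp [H', f, hH]
  let L := cov.liftHomotopy H' f H0
  have hL : ∀ p, Complex.exp (L p : ℂ) = H p / H (0, p.2) := fun p =>
    congrArg Subtype.val (congrFun (cov.liftHomotopy_lifts H' f H0) p)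
  refine ⟨⟨fun a => g a * Complex.exp ((L (1, a) : ℂ) / 2), by fun_prop⟩, fun a => ?_⟩
  have : Complex.exp ((L (1, a) : ℂ) / 2) ^ 2 = H (1, a) / H (0, a) := by
    rw [← Complex.exp_nat_mul, ← hL]
    congr 1
    push_cast
    ring
  simp only [ContinuousMap.coe_mk, mul_pow, hg, this]
  field_simp [hH]

/-- A nowhere vanishing odd function on the circle is not the square of a continuous function. -/
lemma not_exists_sq_eq_of_odd (F : Metric.sphere (0 : ℂ) 1 → ℂ) (hF : ∀ x, F x ≠ 0)
    (hodd : ∀ x, F (-x) = -F x) :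
    ¬ ∃ g : C(Metric.sphere (0 : ℂ) 1, ℂ), ∀ a, g a ^ 2 = F a := by
  rintro ⟨g, hg⟩
  have hgne : ∀ x, g x ≠ 0 := fun x h => hF x (by rw [← hg, h]; simp)
  have hconn : PreconnectedSpace (Metric.sphere (0 : ℂ) 1) :=
    Subtype.preconnectedSpace (isPreconnected_sphere (by simp) 0 1)
  have key := (isPreconnected_univ (α := Metric.sphere (0 : ℂ) 1)).eq_or_eq_neg_of_sq_eq
    (f := fun x => g (-x)) (g := fun x => Complex.I * g x)
    (by fun_prop) (by fun_prop) (by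
      intro x _
      simp [mul_pow, hg, hodd]) (by
      intro x _
      simp [hgne])
  let x : Metric.sphere (0 : ℂ) 1 := ⟨1, by simp⟩
  have hI : ∀ z : ℂ, z = Complex.I * (Complex.I * z) → z = 0 := by
    intro z hz
    rw [← mul_assoc, Complex.I_mul_I] at hz
    linear_combination hz / 2
  rcases key with h | h
  · have h1 := h (Set.mem_univ x)
    have h2 := h (Set.mem_univ (-x))
    simp only [neg_neg] at h1 h2
    rw [h1] at h2
    exact hgne x (hI _ h2)
  · have h1 := h (Set.mem_univ x)
    have h2 := h (Set.mem_univ (-x))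
    simp only [neg_neg, Pi.neg_apply] at h1 h2
    rw [h1] at h2
    exact hgne x (hI _ (by linear_combination h2))

/-- An injective continuous map from the closed unit disk to the plane sends the center to an
interior point of its image. -/
theorem image_closedBall_mem_nhds {f : ℂ → ℂ} (hf : ContinuousOn f (Metric.closedBall 0 1))
    (hinj : Set.InjOn f (Metric.closedBall 0 1)) :
    f '' Metric.closedBall 0 1 ∈ nhds (f 0) := by
  have hS : ∀ x : Metric.sphere (0 : ℂ) 1, ‖(x : ℂ)‖ = 1 := fun x => by simp
  have hmem : ∀ x : Metric.sphere (0 : ℂ) 1, (x : ℂ) ∈ Metric.closedBall (0 : ℂ) 1 := fun x => by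
    simp
  have hfS : Continuous fun x : Metric.sphere (0 : ℂ) 1 => f x :=
    hf.comp_continuous continuous_subtype_val hmem
  have hcenter : ¬ ∃ g : C(Metric.sphere (0 : ℂ) 1, ℂ), ∀ a, g a ^ 2 = f a - f 0 := by
    intro h
    have hpos : ∀ s : unitInterval, (0 : ℝ) < 1 + s := fun s => by linarith [s.2.1]
    have hposC : ∀ s : unitInterval, (1 + (s : ℝ) : ℂ) ≠ 0 := fun s => by
      exact_mod_cast (hpos s).ne'
    have hn : ∀ s : unitInterval, ‖(1 + (s : ℝ) : ℂ)‖ = 1 + s := fun s => by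
      rw [← Complex.ofReal_one, ← Complex.ofReal_add, Complex.norm_real, Real.norm_eq_abs,
        abs_of_pos (hpos s)]
    have hb1 : ∀ p : unitInterval × Metric.sphere (0 : ℂ) 1,
        (p.2 / (1 + (p.1 : ℝ)) : ℂ) ∈ Metric.closedBall (0 : ℂ) 1 := by
      intro p
      rw [mem_closedBall_zero_iff, norm_div, hS, hn, div_le_one (hpos _)]
      linarith [p.1.2.1]
    have hb2 : ∀ p : unitInterval × Metric.sphere (0 : ℂ) 1,
        (-((p.1 : ℝ) * p.2) / (1 + (p.1 : ℝ)) : ℂ) ∈ Metric.closedBall (0 : ℂ) 1 := by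
      intro p
      rw [mem_closedBall_zero_iff, norm_div, norm_neg, norm_mul, hS, hn, div_le_one (hpos _),
        Complex.norm_real, Real.norm_eq_abs, abs_of_nonneg p.1.2.1]
      linarith [p.1.2.1]
    let H : C(unitInterval × Metric.sphere (0 : ℂ) 1, ℂ) :=
      ⟨fun p => f (p.2 / (1 + (p.1 : ℝ))) - f (-((p.1 : ℝ) * p.2) / (1 + (p.1 : ℝ))), by
        refine (hf.comp_continuous ?_ hb1).sub (hf.comp_continuous ?_ hb2)
        · exact Continuous.div (by fun_prop) (by fun_prop) fun p => hposC _
        · exact Continuous.div (by fun_prop) (by fun_prop) fun p => hposC _⟩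
    obtain ⟨g, hg⟩ := exists_sq_eq_of_homotopy H (by
      intro p hp
      have := hinj (hb1 p) (hb2 p) (sub_eq_zero.mp hp)
      have h2 := hposC p.1
      field_simp at this
      have h3 : (p.2 : ℂ) * (1 + (p.1 : ℝ)) = 0 := by linear_combination this
      rcases mul_eq_zero.mp h3 with h4 | h4
      · have := hS p.2
        simp [h4] at this
      · exact h2 h4) (by simpa [H] using h)
    refine not_exists_sq_eq_of_odd (fun x => f (x / 2) - f (-x / 2)) ?_ ?_
      ⟨g, fun a => by rw [hg]; simp [H]; norm_num⟩
    · intro x hx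
      have h1 : ∀ y : ℂ, ‖y‖ = 1 → y / 2 ∈ Metric.closedBall (0 : ℂ) 1 := by
        intro y hy
        simp [hy]
        norm_num
      have h2 := hinj (h1 x (hS x)) (h1 (-x) (by simp)) (sub_eq_zero.mp hx)
      have h3 : (x : ℂ) = 0 := by linear_combination h2
      have := hS x
      simp [h3] at this
    · intro x
      simp
  have hcl : IsClosed (f '' Metric.sphere 0 1) :=
    ((isCompact_sphere (0 : ℂ) 1).image_of_continuousOn
      (hf.mono Metric.sphere_subset_closedBall)).isClosed
  have hnot : f 0 ∈ (f '' Metric.sphere 0 1)ᶜ := by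
    rintro ⟨x, hx, hx0⟩
    have := hinj (Metric.sphere_subset_closedBall hx) (by simp) hx0
    simp [this] at hx
  obtain ⟨δ, hδ, hball⟩ := Metric.isOpen_iff.mp hcl.isOpen_compl _ hnot
  refine Filter.mem_of_superset (Metric.ball_mem_nhds _ hδ) fun q hq => ?_
  by_contra hqf
  apply hcenter
  have hqS : ∃ g : C(Metric.sphere (0 : ℂ) 1, ℂ), ∀ a, g a ^ 2 = f a - q := by
    have hb : ∀ p : unitInterval × Metric.sphere (0 : ℂ) 1,
        ((p.1 : ℝ) * p.2 : ℂ) ∈ Metric.closedBall (0 : ℂ) 1 := by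
      intro p
      rw [mem_closedBall_zero_iff, norm_mul, hS, Complex.norm_real, Real.norm_eq_abs,
        abs_of_nonneg p.1.2.1]
      linarith [p.1.2.2]
    let H : C(unitInterval × Metric.sphere (0 : ℂ) 1, ℂ) :=
      ⟨fun p => f ((p.1 : ℝ) * p.2) - q, by
        refine (hf.comp_continuous ?_ hb).sub continuous_const
        fun_prop⟩
    obtain ⟨c, hc⟩ := IsAlgClosed.exists_pow_nat_eq (f 0 - q) two_pos
    obtain ⟨g, hg⟩ := exists_sq_eq_of_homotopy H
      (fun p hp => hqf ⟨_, hb p, sub_eq_zero.mp hp⟩)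
      ⟨⟨fun _ => c, continuous_const⟩, by simp [H, hc]⟩
    exact ⟨g, by simpa [H] using hg⟩
  let H : C(unitInterval × Metric.sphere (0 : ℂ) 1, ℂ) :=
    ⟨fun p => f p.2 - AffineMap.lineMap q (f 0) (p.1 : ℝ), by
      refine (hfS.comp continuous_snd).sub ?_
      simp only [AffineMap.lineMap_apply]
      fun_prop⟩
  obtain ⟨g, hg⟩ := exists_sq_eq_of_homotopy H (by
    intro p hp
    have h1 : AffineMap.lineMap q (f 0) (p.1 : ℝ) ∈ Metric.ball (f 0) δ :=
      (convex_ball _ _).lineMap_mem hq (Metric.mem_ball_self hδ) p.1.2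
    rw [← sub_eq_zero.mp hp] at h1
    exact hball h1 ⟨_, p.2.2, rfl⟩) (by simpa [H] using hqS)
  exact ⟨g, by simpa [H] using hg⟩

/-! ### The geometric realization in barycentric coordinates -/

/-- The geometric realization of a finite family of finite sets, in barycentric coordinates. -/
def realization (D : Finset (Finset V)) : Set (V → ℝ) :=
  {w | (∀ v, 0 ≤ w v) ∧ ∃ σ ∈ D, (∀ v ∉ σ, w v = 0) ∧ ∑ v ∈ σ, w v = 1}

lemma realization_mono {S D : Finset (Finset V)} (h : S ⊆ D) : realization S ⊆ realization D :=
  fun _ ⟨h0, σ, hσ, h1⟩ => ⟨h0, σ, h hσ, h1⟩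

lemma isCompact_realization (D : Finset (Finset V)) : IsCompact (realization D) := by
  have hD : realization D = ⋃ σ ∈ D, {w : V → ℝ | (∀ v, 0 ≤ w v) ∧ (∀ v ∉ σ, w v = 0) ∧
      ∑ v ∈ σ, w v = 1} := by
    ext w
    simp only [realization, Set.mem_ofPred_eq, Set.mem_iUnion, exists_prop]
    tauto
  rw [hD]
  refine D.finite_toSet.isCompact_biUnion fun σ _ => ?_
  refine (isCompact_univ_pi fun _ : V => isCompact_Icc (a := (0 : ℝ)) (b := 1)).of_isClosed_subset
    ?_ ?_
  · simp only [Set.ofPred_and, Set.ofPred_forall]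
    refine (isClosed_iInter fun v => isClosed_le continuous_const (continuous_apply v)).inter
      ((isClosed_iInter fun v => isClosed_iInter fun _ =>
        isClosed_eq (continuous_apply v) continuous_const).inter
      (isClosed_eq (by fun_prop) continuous_const))
  · rintro w ⟨h0, hz, hs⟩ v -
    refine ⟨h0 v, ?_⟩
    by_cases hv : v ∈ σ
    · rw [← hs]
      exact Finset.single_le_sum (fun i _ => h0 i) hv
    · simp [hz v hv]

lemma mem_of_forall_ne_zero {D : Finset (Finset V)} (hD : IsComplex (D : Set (Finset V)))
    {w : V → ℝ} (hw : w ∈ realization D) {τ : Finset V} (hτ : τ ≠ ∅) (h : ∀ v ∈ τ, w v ≠ 0) :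
    τ ∈ D := by
  obtain ⟨-, σ, hσ, hz, -⟩ := hw
  exact hD.2 σ hσ τ (fun v hv => by_contra fun hn => h v hv (hz v hn)) hτ

lemma exists_ne_zero_of_mem_realization {D : Finset (Finset V)} {w : V → ℝ}
    (hw : w ∈ realization D) : ∃ v, w v ≠ 0 := by
  obtain ⟨-, σ, -, -, hs⟩ := hw
  by_contra! h
  simp [h] at hs

lemma mem_realization_pair {D : Finset (Finset V)} {a b : V} (hab : a ≠ b)
    (h : ({a, b} : Finset V) ∈ D) {s : ℝ} (h0 : 0 ≤ s) (h1 : s ≤ 1) :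
    Pi.single a (1 - s) + Pi.single b s ∈ realization D := by
  refine ⟨fun v => ?_, _, h, fun v hv => ?_, ?_⟩
  · simp only [Pi.add_apply, Pi.single_apply]
    split_ifs <;> linarith
  · simp only [Finset.mem_insert, Finset.mem_singleton, not_or] at hv
    simp [hv.1, hv.2]
  · rw [Finset.sum_pair hab]
    simp [hab, hab.symm]

lemma mem_realization_single {D : Finset (Finset V)} {a : V} (h : ({a} : Finset V) ∈ D) :
    Pi.single a (1 : ℝ) ∈ realization D := by
  refine ⟨fun v => ?_, _, h, fun v hv => ?_, by simp⟩
  · simp only [Pi.single_apply]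
    split_ifs <;> norm_num
  · simp only [Finset.mem_singleton] at hv
    simp [hv]

lemma image_mem_nhds_of_param {X M : Set (V → ℝ)} {j : (V → ℝ) → ℂ} (hj : ContinuousOn j X)
    (hinj : Set.InjOn j X) (hMX : M ⊆ X) {φ : ℂ → V → ℝ} (hφ : Continuous φ)
    (hφi : Function.Injective φ) (hφM : ∀ z, ‖z‖ ≤ 1 → φ z ∈ M) : j '' M ∈ nhds (j (φ 0)) := by
  have hmaps : Set.MapsTo φ (Metric.closedBall 0 1) X := fun z hz => hMX (hφM z (by simpa using hz))
  refine Filter.mem_of_superset (image_closedBall_mem_nhds (f := j ∘ φ)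
    (hj.comp hφ.continuousOn hmaps) (hinj.comp hφi.injOn hmaps)) ?_
  rintro _ ⟨z, hz, rfl⟩
  exact ⟨φ z, hφM z (by simpa using hz), rfl⟩

lemma abs_re_le_of_norm_le {z : ℂ} (hz : ‖z‖ ≤ 1) : -1 ≤ z.re ∧ z.re ≤ 1 :=
  abs_le.mp ((Complex.abs_re_le_norm z).trans hz)

lemma abs_im_le_of_norm_le {z : ℂ} (hz : ‖z‖ ≤ 1) : -1 ≤ z.im ∧ z.im ≤ 1 :=
  abs_le.mp ((Complex.abs_im_le_norm z).trans hz)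

/-- An embedding of a complex in the plane is open at points inside an edge lying in two
triangles. -/
lemma image_mem_nhds_of_edge {S : Finset (Finset V)} {X : Set (V → ℝ)}
    (hSX : realization S ⊆ X) {j : (V → ℝ) → ℂ} (hj : ContinuousOn j X) (hinj : Set.InjOn j X)
    {a b c d : V} (hab : a ≠ b) (hac : a ≠ c) (hbc : b ≠ c) (had : a ≠ d) (hbd : b ≠ d)
    (hcd : c ≠ d) (hc : {a, b, c} ∈ S) (hd : {a, b, d} ∈ S) {w : V → ℝ} (ha0 : 0 < w a)
    (hb0 : 0 < w b) (hz : ∀ v, v ≠ a → v ≠ b → w v = 0) (hw : w a + w b = 1) :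
    j '' realization S ∈ nhds (j w) := by
  obtain ⟨ε, hε, hεa, hεb⟩ : ∃ ε : ℝ, 0 < ε ∧ 2 * ε ≤ w a ∧ 2 * ε ≤ w b :=
    ⟨min (w a) (w b) / 2, by positivity, by linarith [min_le_left (w a) (w b)],
      by linarith [min_le_right (w a) (w b)]⟩
  have hwc := hz c hac.symm hbc.symm
  have hwd := hz d had.symm hbd.symm
  let φ : ℂ → V → ℝ := fun z => w + Pi.single a (ε * (z.re - |z.im|)) + Pi.single b (-(ε * z.re)) +
    Pi.single c (ε * max z.im 0) + Pi.single d (ε * max (-z.im) 0)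
  have hφa : ∀ z, φ z a = w a + ε * (z.re - |z.im|) := fun z => by
    simp [φ, hab, hac, had]
  have hφb : ∀ z, φ z b = w b - ε * z.re := fun z => by
    simp [φ, hab.symm, hbc, hbd]; ring
  have hφc : ∀ z, φ z c = ε * max z.im 0 := fun z => by
    simp [φ, hac.symm, hbc.symm, hcd, hwc]
  have hφd : ∀ z, φ z d = ε * max (-z.im) 0 := fun z => by
    simp [φ, had.symm, hbd.symm, hcd.symm, hwd]
  have hφv : ∀ z v, v ≠ a → v ≠ b → v ≠ c → v ≠ d → φ z v = 0 := fun z v h1 h2 h3 h4 => by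
    simp [φ, h1, h2, h3, h4, hz v h1 h2]
  have h0 : φ 0 = w := by simp [φ]
  rw [← h0]
  refine image_mem_nhds_of_param hj hinj hSX (φ := φ) ?_ ?_ ?_
  · refine continuous_pi fun v => ?_
    simp only [φ, Pi.add_apply, Pi.single_apply]
    have h1 := Complex.continuous_re
    have h2 := Complex.continuous_im
    refine ((((continuous_const).add ?_).add ?_).add ?_).add ?_ <;> split_ifs <;> fun_prop
  · intro z z' h
    have hb' := congrFun h b
    have hc' := congrFun h c
    have hd' := congrFun h d
    rw [hφb, hφb] at hb'
    rw [hφc, hφc] at hc'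
    rw [hφd, hφd] at hd'
    have h1 := mul_left_cancel₀ hε.ne' hc'
    have h2 := mul_left_cancel₀ hε.ne' hd'
    refine Complex.ext (mul_left_cancel₀ hε.ne' (by linarith)) ?_
    grind
  · intro z hz1
    obtain ⟨r1, r2⟩ := abs_re_le_of_norm_le hz1
    obtain ⟨i1, i2⟩ := abs_im_le_of_norm_le hz1
    have habs : |z.im| ≤ 1 := abs_le.mpr ⟨i1, i2⟩
    have hnn : ∀ v, 0 ≤ φ z v := by
      intro v
      by_cases va : v = a
      · rw [va, hφa]; nlinarith
      by_cases vb : v = b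
      · rw [vb, hφb]; nlinarith
      by_cases vc : v = c
      · rw [vc, hφc]; positivity
      by_cases vd : v = d
      · rw [vd, hφd]; positivity
      exact (hφv z v va vb vc vd).ge
    rcases le_total 0 z.im with him | him
    · refine ⟨hnn, _, hc, fun v hv => ?_, ?_⟩
      · simp only [Finset.mem_insert, Finset.mem_singleton, not_or] at hv
        by_cases vd : v = d
        · rw [vd, hφd, max_eq_right (by linarith), mul_zero]
        · exact hφv z v hv.1 hv.2.1 hv.2.2 vd
      · rw [Finset.sum_insert (by simp [hab, hac]), Finset.sum_pair hbc, hφa, hφb, hφc,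
          abs_of_nonneg him, max_eq_left him]
        linarith
    · refine ⟨hnn, _, hd, fun v hv => ?_, ?_⟩
      · simp only [Finset.mem_insert, Finset.mem_singleton, not_or] at hv
        by_cases vc : v = c
        · rw [vc, hφc, max_eq_right (by linarith), mul_zero]
        · exact hφv z v hv.1 hv.2.1 vc hv.2.2
      · rw [Finset.sum_insert (by simp [hab, had]), Finset.sum_pair hbd, hφa, hφb, hφd,
          abs_of_nonpos him, max_eq_left (by linarith)]
        linarith

/-- An embedding of a complex in the plane is open at points inside a triangle. -/
lemma image_mem_nhds_of_triangle {S : Finset (Finset V)} {X : Set (V → ℝ)}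
    (hSX : realization S ⊆ X) {j : (V → ℝ) → ℂ} (hj : ContinuousOn j X) (hinj : Set.InjOn j X)
    {a b c : V} (hab : a ≠ b) (hac : a ≠ c) (hbc : b ≠ c) (hc : {a, b, c} ∈ S) {w : V → ℝ}
    (ha0 : 0 < w a) (hb0 : 0 < w b) (hc0 : 0 < w c)
    (hz : ∀ v, v ≠ a → v ≠ b → v ≠ c → w v = 0) (hw : w a + w b + w c = 1) :
    j '' realization S ∈ nhds (j w) := by
  obtain ⟨ε, hε, hεa, hεb, hεc⟩ : ∃ ε : ℝ, 0 < ε ∧ 2 * ε ≤ w a ∧ 2 * ε ≤ w b ∧ 2 * ε ≤ w c :=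
    ⟨min (w a) (min (w b) (w c)) / 2, by positivity,
      by linarith [min_le_left (w a) (min (w b) (w c))],
      by linarith [min_le_right (w a) (min (w b) (w c)), min_le_left (w b) (w c)],
      by linarith [min_le_right (w a) (min (w b) (w c)), min_le_right (w b) (w c)]⟩
  let φ : ℂ → V → ℝ := fun z => w + Pi.single a (ε * (z.re - z.im)) + Pi.single b (-(ε * z.re)) +
    Pi.single c (ε * z.im)
  have hφa : ∀ z, φ z a = w a + ε * (z.re - z.im) := fun z => by
    simp [φ, hab, hac]
  have hφb : ∀ z, φ z b = w b - ε * z.re := fun z => by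
    simp [φ, hab.symm, hbc]; ring
  have hφc : ∀ z, φ z c = w c + ε * z.im := fun z => by
    simp [φ, hac.symm, hbc.symm]
  have hφv : ∀ z v, v ≠ a → v ≠ b → v ≠ c → φ z v = 0 := fun z v h1 h2 h3 => by
    simp [φ, h1, h2, h3, hz v h1 h2 h3]
  have h0 : φ 0 = w := by simp [φ]
  rw [← h0]
  refine image_mem_nhds_of_param hj hinj hSX (φ := φ) ?_ ?_ ?_
  · refine continuous_pi fun v => ?_
    simp only [φ, Pi.add_apply, Pi.single_apply]
    have h1 := Complex.continuous_re
    have h2 := Complex.continuous_im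
    refine (((continuous_const).add ?_).add ?_).add ?_ <;> split_ifs <;> fun_prop
  · intro z z' h
    have hb' := congrFun h b
    have hc' := congrFun h c
    rw [hφb, hφb] at hb'
    rw [hφc, hφc] at hc'
    exact Complex.ext (mul_left_cancel₀ hε.ne' (by linarith))
      (mul_left_cancel₀ hε.ne' (by linarith))
  · intro z hz1
    obtain ⟨r1, r2⟩ := abs_re_le_of_norm_le hz1
    obtain ⟨i1, i2⟩ := abs_im_le_of_norm_le hz1
    refine ⟨fun v => ?_, _, hc, fun v hv => ?_, ?_⟩
    · by_cases va : v = a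
      · rw [va, hφa]; nlinarith
      by_cases vb : v = b
      · rw [vb, hφb]; nlinarith
      by_cases vc : v = c
      · rw [vc, hφc]; nlinarith
      exact (hφv z v va vb vc).ge
    · simp only [Finset.mem_insert, Finset.mem_singleton, not_or] at hv
      exact hφv z v hv.1 hv.2.1 hv.2.2
    · rw [Finset.sum_insert (by simp [hab, hac]), Finset.sum_pair hbc, hφa, hφb, hφc]
      linarith

/-- In a complex embedded in the plane no edge lies in three triangles. -/
lemma not_three_triangles {D : Finset (Finset V)} {j : (V → ℝ) → ℂ}
    (hj : ContinuousOn j (realization D)) (hinj : Set.InjOn j (realization D))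
    {a b c d e : V} (hab : a ≠ b) (hac : a ≠ c) (hbc : b ≠ c) (had : a ≠ d) (hbd : b ≠ d)
    (hcd : c ≠ d) (hae : a ≠ e) (hbe : b ≠ e) (hce : c ≠ e) (hde : d ≠ e)
    (hc : {a, b, c} ∈ D) (hd : {a, b, d} ∈ D) (he : {a, b, e} ∈ D) : False := by
  let S : Finset (Finset V) := {{a, b, c}, {a, b, d}}
  have hSD : S ⊆ D := by
    intro t ht
    simp only [S, Finset.mem_insert, Finset.mem_singleton] at ht
    rcases ht with rfl | rfl <;> assumption
  let ψ : ℝ → V → ℝ := fun t => Pi.single a (1 / 2 - t) + Pi.single b (1 / 2) + Pi.single e t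
  have hψa : ∀ t, ψ t a = 1 / 2 - t := fun t => by simp [ψ, hab, hae]
  have hψb : ∀ t, ψ t b = 1 / 2 := fun t => by simp [ψ, hab.symm, hbe]
  have hψe : ∀ t, ψ t e = t := fun t => by simp [ψ, hae.symm, hbe.symm]
  have hψv : ∀ t v, v ≠ a → v ≠ b → v ≠ e → ψ t v = 0 := fun t v h1 h2 h3 => by
    simp [ψ, h1, h2, h3]
  have hψD : ∀ t ∈ Set.Icc (0 : ℝ) (1 / 2), ψ t ∈ realization D := by
    rintro t ⟨h0, h1⟩
    refine ⟨fun v => ?_, _, he, fun v hv => ?_, ?_⟩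
    · by_cases va : v = a
      · rw [va, hψa]; linarith
      by_cases vb : v = b
      · rw [vb, hψb]; norm_num
      by_cases ve : v = e
      · rw [ve, hψe]; exact h0
      exact (hψv t v va vb ve).ge
    · simp only [Finset.mem_insert, Finset.mem_singleton, not_or] at hv
      exact hψv t v hv.1 hv.2.1 hv.2.2
    · rw [Finset.sum_insert (by simp [hab, hae]), Finset.sum_pair hbe, hψa, hψb, hψe]
      linarith
  have hψc : Continuous ψ := by
    refine continuous_pi fun v => ?_
    simp only [ψ, Pi.add_apply, Pi.single_apply]
    refine (Continuous.add ?_ ?_).add ?_ <;> split_ifs <;> fun_prop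
  have hnhds : j '' realization S ∈ nhds (j (ψ 0)) :=
    image_mem_nhds_of_edge (realization_mono hSD) hj hinj hab hac hbc had hbd hcd
      (by simp [S]) (by simp [S]) (by rw [hψa]; norm_num) (by rw [hψb]; norm_num)
      (fun v h1 h2 => by
        by_cases ve : v = e
        · rw [ve, hψe]
        · exact hψv 0 v h1 h2 ve) (by rw [hψa, hψb]; norm_num)
  have hcont : ContinuousWithinAt (j ∘ ψ) (Set.Icc 0 (1 / 2)) 0 :=
    (hj.comp hψc.continuousOn hψD) 0 ⟨le_rfl, by norm_num⟩
  obtain ⟨δ, hδ, hball⟩ := Metric.mem_nhdsWithin_iff.mp (hcont hnhds)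
  let t := min (δ / 2) (1 / 2)
  have ht0 : 0 < t := by positivity
  have ht1 : t ≤ 1 / 2 := min_le_right _ _
  have htδ : t < δ := (min_le_left _ _).trans_lt (by linarith)
  obtain ⟨m, hm, hmt⟩ := hball ⟨by simpa [abs_of_pos ht0] using htδ, ht0.le, ht1⟩
  have hmt' : m = ψ t := hinj (realization_mono hSD hm) (hψD t ⟨ht0.le, ht1⟩) hmt
  obtain ⟨-, σ, hσ, hσz, -⟩ := hm
  have : m e = 0 := by
    apply hσz
    simp only [S, Finset.mem_insert, Finset.mem_singleton] at hσ
    rcases hσ with rfl | rfl <;> simp [hae.symm, hbe.symm, hce.symm, hde.symm]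
  rw [hmt', hψe] at this
  exact ht0.ne' this

/-- A complex embedded in the plane contains no nonempty set of triangles without boundary. -/
lemma not_closed_surface {S : Finset (Finset V)} {j : (V → ℝ) → ℂ}
    (hj : ContinuousOn j (realization S)) (hinj : Set.InjOn j (realization S))
    (hne : S.Nonempty) (hcard : ∀ t ∈ S, t.card = 3)
    (hadj : ∀ t ∈ S, ∀ e ⊆ t, e.card = 2 → ∃ t' ∈ S, t' ≠ t ∧ e ⊆ t') : False := by
  let P : Set ℂ := (fun v => j (Pi.single v 1)) '' (S.biUnion id : Finset V)
  have hP : P.Finite := (Finset.finite_toSet _).image _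
  have hC : IsCompact (j '' realization S) := (isCompact_realization S).image_of_continuousOn hj
  have hint : ∀ z ∈ j '' realization S, z ∉ P → z ∈ interior (j '' realization S) := by
    rintro _ ⟨w, ⟨h0, t, ht, hz, hs⟩, rfl⟩ hzP
    rw [mem_interior_iff_mem_nhds]
    set τ := t.filter fun v => w v ≠ 0 with hτ
    have hτt : τ ⊆ t := Finset.filter_subset _ _
    have hτs : ∑ v ∈ τ, w v = 1 := by rw [← hs, Finset.sum_filter_ne_zero]
    have hτz : ∀ v ∉ τ, w v = 0 := by
      intro v hv
      by_cases hvt : v ∈ t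
      · by_contra h
        exact hv (Finset.mem_filter.mpr ⟨hvt, h⟩)
      · exact hz v hvt
    have hpos : ∀ v ∈ τ, 0 < w v := fun v hv =>
      lt_of_le_of_ne (h0 v) (Ne.symm (Finset.mem_filter.mp hv).2)
    have hle : τ.card ≤ 3 := (Finset.card_le_card hτt).trans (hcard t ht).le
    interval_cases hk : τ.card
    · simp [Finset.card_eq_zero.mp hk] at hτs
    · obtain ⟨v, hv⟩ := Finset.card_eq_one.mp hk
      exfalso
      refine hzP ⟨v, ?_, ?_⟩
      · simp only [Finset.coe_biUnion, Set.mem_iUnion]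
        exact ⟨t, ht, hτt (by simp [hv])⟩
      · refine congrArg j (funext fun u => ?_)
        by_cases huv : u = v
        · rw [hv, Finset.sum_singleton] at hτs
          simp [huv, hτs]
        · rw [hτz u (by simp [hv, huv])]
          simp [huv]
    · obtain ⟨a, b, hab, hτab⟩ := Finset.card_eq_two.mp hk
      obtain ⟨t', ht', hne', hsub⟩ := hadj t ht τ hτt hk
      have third : ∀ s ∈ S, τ ⊆ s → ∃ c, a ≠ c ∧ b ≠ c ∧ s = {a, b, c} := by
        intro s hs hτs
        obtain ⟨c, hc⟩ := Finset.card_eq_one.mp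
          (show (s \ τ).card = 1 by rw [Finset.card_sdiff_of_subset hτs, hcard s hs, hk])
        have hcs : c ∈ s \ τ := by simp [hc]
        have hcτ := (Finset.mem_sdiff.mp hcs).2
        simp only [hτab, Finset.mem_insert, Finset.mem_singleton, not_or] at hcτ
        refine ⟨c, Ne.symm hcτ.1, Ne.symm hcτ.2, ?_⟩
        rw [← Finset.union_sdiff_of_subset hτs, hc, hτab]
        ext; simp
      obtain ⟨c, hac, hbc, rfl⟩ := third t ht hτt
      obtain ⟨d, had, hbd, rfl⟩ := third t' ht' hsub
      rw [hτab, Finset.sum_pair hab] at hτs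
      refine image_mem_nhds_of_edge subset_rfl hj hinj hab hac hbc had hbd ?_ ht ht'
        (hpos a (by simp [hτab])) (hpos b (by simp [hτab]))
        (fun v h1 h2 => hτz v (by simp [hτab, h1, h2])) hτs
      rintro rfl
      exact hne' rfl
    · have hτeq : τ = t := Finset.eq_of_subset_of_card_le hτt (by rw [hcard t ht, hk])
      obtain ⟨a, b, c, hab, hac, hbc, habc⟩ := Finset.card_eq_three.mp hk
      rw [habc, Finset.sum_insert (by simp [hab, hac]), Finset.sum_pair hbc] at hτs
      exact image_mem_nhds_of_triangle subset_rfl hj hinj hab hac hbc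
        (by rwa [← habc, hτeq]) (hpos a (by simp [habc])) (hpos b (by simp [habc]))
        (hpos c (by simp [habc])) (fun v h1 h2 h3 => hτz v (by simp [habc, h1, h2, h3]))
        (by linarith)
  have hconn : IsPreconnected Pᶜ :=
    (hP.countable.isConnected_compl_of_one_lt_rank (by simp)).isPreconnected
  have hsub := hconn.subset_left_of_subset_union isOpen_interior hC.isClosed.isOpen_compl
    (disjoint_compl_right.mono_left interior_subset)
    (fun z hz => by
      by_cases h : z ∈ j '' realization S
      · exact Or.inl (hint z h hz)
      · exact Or.inr h) (by
      obtain ⟨t, ht⟩ := hne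
      obtain ⟨a, b, c, hab, hac, hbc, rfl⟩ := Finset.card_eq_three.mp (hcard t ht)
      let w : V → ℝ := fun v => if v ∈ ({a, b, c} : Finset V) then 1 / 3 else 0
      have hwa : w a = 1 / 3 := by simp [w]
      have hw : w ∈ realization S := by
        refine ⟨fun v => ?_, _, ht, fun v hv => by simp only [w, if_neg hv], ?_⟩
        · simp only [w]
          split_ifs <;> norm_num
        · simp only [w, Finset.sum_ite_mem, Finset.inter_self, Finset.sum_const, hcard _ ht]
          norm_num
      have hwP : j w ∉ P := by
        rintro ⟨v, hv, hvw⟩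
        have hvS : Pi.single v (1 : ℝ) ∈ realization S := by
          simp only [Finset.coe_biUnion, Set.mem_iUnion] at hv
          obtain ⟨t, htS, hvt⟩ := hv
          refine ⟨fun u => ?_, t, htS, fun u hu => ?_, ?_⟩
          · simp only [Pi.single_apply]
            split_ifs <;> norm_num
          · have : u ≠ v := by
              rintro rfl
              exact hu hvt
            simp [this]
          · rw [Finset.sum_pi_single']
            exact if_pos hvt
        have hvw' := hinj hvS hw hvw
        have h1 := congrFun hvw' a
        rw [hwa, Pi.single_apply] at h1
        split_ifs at h1 <;> norm_num at h1
      exact ⟨j w, hwP, hint _ ⟨w, hw, rfl⟩ hwP⟩)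
  have huniv : (Set.univ : Set ℂ) = j '' realization S ∪ P := by
    ext z
    simp only [Set.mem_univ, true_iff]
    by_cases hz : z ∈ P
    · exact Or.inr hz
    · exact Or.inl (interior_subset (hsub hz))
  exact noncompact_univ ℂ (huniv ▸ hC.union hP.isCompact)

/-! ### Connectedness of the complex and of its links -/

lemma eq_single_of_forall_eq_zero {D : Finset (Finset V)} {w : V → ℝ} (hw : w ∈ realization D)
    {v : V} (h : ∀ u, u ≠ v → w u = 0) : w = Pi.single v 1 := by
  obtain ⟨-, σ, -, hz, hs⟩ := hw
  funext u
  by_cases hu : u = v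
  · subst hu
    rw [Finset.sum_eq_single u (fun x _ hx => h x hx) (fun hu => hz u hu)] at hs
    simpa using hs
  · simp [hu, h u hu]

lemma isOpen_exists_pos (X : Set (V → ℝ)) (A : Set V) : IsOpen {w : X | ∃ a ∈ A, 0 < w.1 a} := by
  have : {w : X | ∃ a ∈ A, 0 < w.1 a} = ⋃ a ∈ A, {w : X | 0 < w.1 a} := by
    ext
    simp
  rw [this]
  exact isOpen_biUnion fun a _ =>
    isOpen_lt continuous_const ((continuous_apply a).comp continuous_subtype_val)

/-- In a complex with connected realization, a nonempty set of vertices closed under adjacency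
contains all vertices. -/
lemma mem_of_closed_under_adj {D : Finset (Finset V)} (hD : IsComplex (D : Set (Finset V)))
    [PreconnectedSpace (realization D)] {A : Set V} {a₀ : V} (ha₀ : a₀ ∈ A) (ha₀D : {a₀} ∈ D)
    (hA : ∀ a ∈ A, ∀ b, {a, b} ∈ D → b ∈ A) {b : V} (hb : {b} ∈ D) : b ∈ A := by
  by_contra hbA
  obtain ⟨w, -, ⟨a, ha, hwa⟩, ⟨c, hc, hwc⟩⟩ :=
    isPreconnected_univ (α := realization D) _ _ (isOpen_exists_pos _ A) (isOpen_exists_pos _ Aᶜ)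
      (fun w _ => by
        obtain ⟨v, hv⟩ := exists_ne_zero_of_mem_realization w.2
        have hv' : 0 < w.1 v := lt_of_le_of_ne (w.2.1 v) hv.symm
        by_cases h : v ∈ A
        · exact Or.inl ⟨v, h, hv'⟩
        · exact Or.inr ⟨v, h, hv'⟩)
      ⟨⟨_, mem_realization_single ha₀D⟩, trivial, a₀, ha₀, by simp⟩
      ⟨⟨_, mem_realization_single hb⟩, trivial, b, hbA, by simp⟩
  exact hc (hA a ha c (mem_of_forall_ne_zero hD w.2 (by simp) (by simp [hwa.ne', hwc.ne'])))

/-- If removing a vertex does not disconnect the realization locally, then a nonempty set of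
neighbours of the vertex which is closed under adjacency in the link contains all neighbours. -/
lemma mem_of_closed_under_link_adj {D : Finset (Finset V)} (hD : IsComplex (D : Set (Finset V)))
    (hloc : ∀ x : realization D, ∀ U ∈ nhds x, ∃ W ∈ nhds x, W ⊆ U ∧ IsPreconnected (W \ {x}))
    {v : V} {A : Set V} {a₀ : V} (hva₀ : v ≠ a₀) (ha₀ : a₀ ∈ A) (ha₀D : {v, a₀} ∈ D)
    (hA : ∀ a ∈ A, a ≠ v → ∀ b, b ≠ v → {v, a, b} ∈ D → b ∈ A) {b : V} (hvb : v ≠ b)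
    (hb : {v, b} ∈ D) : b ∈ A := by
  by_contra hbA
  have hvD : {v} ∈ D := hD.2 _ ha₀D _ (by simp) (by simp)
  let x : realization D := ⟨Pi.single v 1, mem_realization_single hvD⟩
  obtain ⟨W, hW, hWU, hWc⟩ := hloc x {w | ∃ a ∈ ({v} : Set V), 0 < w.1 a}
    ((isOpen_exists_pos _ {v}).mem_nhds ⟨v, rfl, by simp [x]⟩)
  have hWU' : ∀ w ∈ W, w.1 v ≠ 0 := fun w hw => by
    obtain ⟨_, rfl, h⟩ := hWU hw
    exact h.ne'
  have hit : ∀ a, v ≠ a → {v, a} ∈ D → ∃ w ∈ W \ {x}, 0 < w.1 a := by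
    intro a hva haD
    let ψ : Set.Icc (0 : ℝ) 1 → realization D := fun t =>
      ⟨Pi.single v (1 - (t : ℝ)) + Pi.single a (t : ℝ), mem_realization_pair hva haD t.2.1 t.2.2⟩
    have hψc : Continuous ψ := by
      refine Continuous.subtype_mk (continuous_pi fun u => ?_) _
      simp only [Pi.add_apply, Pi.single_apply]
      refine Continuous.add ?_ ?_ <;> split_ifs <;> fun_prop
    have hψ0 : ψ 0 = x := by
      ext u
      simp [ψ, x]
    have hψW : ψ ⁻¹' W ∈ nhds 0 := hψc.continuousAt (by rwa [hψ0])
    obtain ⟨δ, hδ, hball⟩ := Metric.mem_nhds_iff.mp hψW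
    have ht0 : 0 < min (δ / 2) 1 := by positivity
    let t : Set.Icc (0 : ℝ) 1 := ⟨min (δ / 2) 1, ht0.le, min_le_right _ _⟩
    have hta : (ψ t).1 a = min (δ / 2) 1 := by simp [ψ, t, hva.symm]
    refine ⟨ψ t, ⟨hball ?_, fun h => ?_⟩, by rw [hta]; exact ht0⟩
    · rw [Metric.mem_ball, Subtype.dist_eq, Real.dist_eq]
      simp only [t, Set.Icc.coe_zero, sub_zero, abs_of_pos ht0]
      exact (min_le_left _ _).trans_lt (by linarith)
    · have h' : (ψ t).1 a = x.1 a := by rw [h]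
      rw [hta] at h'
      simp only [x, Pi.single_apply, hva.symm, if_false] at h'
      exact ht0.ne' h'
  obtain ⟨wa, hwa, hwa'⟩ := hit a₀ hva₀ ha₀D
  obtain ⟨wb, hwb, hwb'⟩ := hit b hvb hb
  obtain ⟨w, hw, ⟨a, ⟨ha, hav⟩, hwa⟩, ⟨c, ⟨hc, hcv⟩, hwc⟩⟩ :=
    hWc _ _ (isOpen_exists_pos _ (A \ {v})) (isOpen_exists_pos _ (Aᶜ \ {v}))
      (fun w hw => by
        have : ∃ u, u ≠ v ∧ w.1 u ≠ 0 := by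
          by_contra! h
          exact hw.2 (Subtype.ext (eq_single_of_forall_eq_zero w.2 h))
        obtain ⟨u, huv, hu⟩ := this
        have hu' : 0 < w.1 u := lt_of_le_of_ne (w.2.1 u) hu.symm
        by_cases h : u ∈ A
        · exact Or.inl ⟨u, ⟨h, huv⟩, hu'⟩
        · exact Or.inr ⟨u, ⟨h, huv⟩, hu'⟩)
      ⟨wa, hwa, a₀, ⟨ha₀, hva₀.symm⟩, hwa'⟩ ⟨wb, hwb, b, ⟨hbA, hvb.symm⟩, hwb'⟩
  exact hc (hA a ha hav c hcv (mem_of_forall_ne_zero hD w.2 (by simp)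
    (by simp [hWU' w hw.1, hwa.ne', hwc.ne'])))

/-- Removing a point does not disconnect a convex open subset of the plane. -/
lemma isPreconnected_sdiff_singleton_of_convex {O : Set ℂ} (hc : Convex ℝ O) (ho : IsOpen O)
    (x : ℂ) : IsPreconnected (O \ {x}) := by
  by_cases hx : x ∈ O
  swap
  · rw [Set.sdiff_singleton_eq_self hx]
    exact hc.isPreconnected
  obtain ⟨ε, hε, hball⟩ := Metric.isOpen_iff.mp ho x hx
  have hmem : ∀ s t : ℝ, |s| ≤ 1 → |t| ≤ 1 →
      (⟨x.re + ε / 4 * s, x.im + ε / 4 * t⟩ : ℂ) ∈ O := by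
    intro s t hs ht
    refine hball ?_
    rw [Metric.mem_ball, dist_eq_norm]
    refine (Complex.norm_le_abs_re_add_abs_im _).trans_lt ?_
    simp only [Complex.sub_re, Complex.sub_im, add_sub_cancel_left, abs_mul,
      abs_of_pos (by positivity : 0 < ε / 4)]
    nlinarith
  have h1 : IsPreconnected (O ∩ {z | x.re < z.re}) :=
    (hc.inter (convex_halfSpace_re_gt x.re)).isPreconnected
  have h2 : IsPreconnected (O ∩ {z | x.im < z.im}) :=
    (hc.inter (convex_halfSpace_im_gt x.im)).isPreconnected
  have h3 : IsPreconnected (O ∩ {z | z.re < x.re}) :=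
    (hc.inter (convex_halfSpace_re_lt x.re)).isPreconnected
  have h4 : IsPreconnected (O ∩ {z | z.im < x.im}) :=
    (hc.inter (convex_halfSpace_im_lt x.im)).isPreconnected
  have h12 := IsPreconnected.union (⟨x.re + ε / 4 * 1, x.im + ε / 4 * 1⟩ : ℂ)
    (by exact ⟨hmem 1 1 (by simp) (by simp), by simp [hε]⟩)
    (by exact ⟨hmem 1 1 (by simp) (by simp), by simp [hε]⟩) h1 h2
  have h34 := IsPreconnected.union (⟨x.re + ε / 4 * (-1), x.im + ε / 4 * (-1)⟩ : ℂ)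
    (by exact ⟨hmem (-1) (-1) (by simp) (by simp), by simp [hε]⟩)
    (by exact ⟨hmem (-1) (-1) (by simp) (by simp), by simp [hε]⟩) h3 h4
  have h := IsPreconnected.union (⟨x.re + ε / 4 * 1, x.im + ε / 4 * (-1)⟩ : ℂ)
    (by exact Or.inl ⟨hmem 1 (-1) (by simp) (by simp), by simp [hε]⟩)
    (by exact Or.inr ⟨hmem 1 (-1) (by simp) (by simp), by simp [hε]⟩) h12 h34
  convert h using 1
  ext z
  simp only [Set.mem_sdiff, Set.mem_singleton_iff, Complex.ext_iff, Set.mem_union,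
    Set.mem_inter_iff,
    Set.mem_ofPred_eq]
  constructor
  · rintro ⟨hz, hne⟩
    rcases lt_trichotomy z.re x.re with h | h | h <;>
      rcases lt_trichotomy z.im x.im with h' | h' | h' <;> tauto
  · rintro ((⟨hz, h⟩ | ⟨hz, h⟩) | (⟨hz, h⟩ | ⟨hz, h⟩)) <;>
      exact ⟨hz, fun h' => by linarith [h'.1, h'.2]⟩

/-- Points do not disconnect a closed disk locally. -/
lemma closedBall_exists_nhds_isPreconnected_diff (x : Metric.closedBall (0 : ℂ) 1)
    (U : Set (Metric.closedBall (0 : ℂ) 1)) (hU : U ∈ nhds x) :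
    ∃ W ∈ nhds x, W ⊆ U ∧ IsPreconnected (W \ {x}) := by
  obtain ⟨ε, hε, hball⟩ := Metric.mem_nhds_iff.mp hU
  refine ⟨Metric.ball x ε, Metric.ball_mem_nhds _ hε, hball, ?_⟩
  rw [← Topology.IsInducing.subtypeVal.isPreconnected_image]
  set C : Set ℂ := Metric.closedBall 0 1 ∩ Metric.ball (x : ℂ) ε with hCdef
  have himg : Subtype.val '' (Metric.ball x ε \ {x}) = C \ {(x : ℂ)} := by
    ext z
    constructor
    · rintro ⟨y, ⟨hy, hyx⟩, rfl⟩
      exact ⟨⟨y.2, hy⟩, fun h => hyx (Subtype.ext h)⟩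
    · rintro ⟨⟨hz1, hz2⟩, hzx⟩
      exact ⟨⟨z, hz1⟩, ⟨hz2, fun h => hzx (congrArg Subtype.val h)⟩, rfl⟩
  rw [himg]
  have hconv : Convex ℝ C := (convex_closedBall _ _).inter (convex_ball _ _)
  have hint : (interior C).Nonempty := by
    rw [hCdef, interior_inter, interior_closedBall _ one_ne_zero, Metric.isOpen_ball.interior_eq]
    have hx : (x : ℂ) ∈ closure (Metric.ball (0 : ℂ) 1) := by
      rw [closure_ball _ one_ne_zero]
      exact x.2
    obtain ⟨y, hy1, hy2⟩ := mem_closure_iff.mp hx _ Metric.isOpen_ball (Metric.mem_ball_self hε)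
    exact ⟨y, hy2, hy1⟩
  have hpre : IsPreconnected (interior C \ {(x : ℂ)}) :=
    isPreconnected_sdiff_singleton_of_convex hconv.interior isOpen_interior x
  refine hpre.subset_closure (Set.sdiff_subset_sdiff_left interior_subset) ?_
  rintro z ⟨hz, hzx⟩
  have hz' : z ∈ closure (interior C) := by
    rw [hconv.closure_interior_eq_closure_of_nonempty_interior hint]
    exact subset_closure hz
  exact isOpen_compl_singleton.closure_inter ⟨hz', hzx⟩

/-! ### Cocycles on simply connected complexes -/

/-- A one-cocycle with coefficients in `ℤ/2` on a simply connected complex is a coboundary. -/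
lemma exists_eq_sub_of_cocycle {D : Finset (Finset V)} (hD : IsComplex (D : Set (Finset V)))
    [SimplyConnectedSpace (realization D)] [LocallyPathConnectedSpace (realization D)]
    (c : V → V → ZMod 2) (hc0 : ∀ a, c a a = 0)
    (hc : ∀ a b d, {a, b, d} ∈ D → c a b + c b d = c a d) :
    ∃ g : V → ZMod 2, ∀ a b, {a, b} ∈ D → c a b = g b - g a := by
  have hex : ∀ x : realization D, ∃ v, x.1 v ≠ 0 := fun x =>
    exists_ne_zero_of_mem_realization x.2
  choose i hi using hex
  let Z : FiberBundleCore V (realization D) (ZMod 2) :=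
    { baseSet := fun v => {x | x.1 v ≠ 0}
      isOpen_baseSet := fun v =>
        isOpen_ne_fun ((continuous_apply v).comp continuous_subtype_val) continuous_const
      indexAt := i
      mem_baseSet_at := hi
      coordChange := fun a b _ s => s + c a b
      coordChange_self := fun a x _ s => by simp [hc0]
      continuousOn_coordChange := fun a b => by fun_prop
      coordChange_comp := fun a b d x hx s => by
        obtain ⟨⟨h1, h2⟩, h3⟩ := hx
        rw [← hc a b d (mem_of_forall_ne_zero hD x.2 (by simp) ?_), add_assoc]
        intro v hv
        simp only [Finset.mem_insert, Finset.mem_singleton] at hv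
        rcases hv with rfl | rfl | rfl <;> assumption }
  have cov : IsCoveringMap Z.proj :=
    IsFiberBundle.isCoveringMap fun x => ⟨Z.localTriv (Z.indexAt x), Z.mem_baseSet_at x⟩
  obtain ⟨x₀⟩ : Nonempty (realization D) := inferInstance
  obtain ⟨s, ⟨-, hs⟩, -⟩ := cov.existsUnique_continuousMap_lifts
    (ContinuousMap.id (realization D)) x₀ (⟨x₀, (0 : ZMod 2)⟩ : Z.TotalSpace) rfl
  have hs' : ∀ x, Z.proj (s x) = x := fun x => congrFun hs x
  let f : V → realization D → ZMod 2 := fun a x => (Z.localTriv a (s x)).2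
  have hfc : ∀ a, ContinuousOn (f a) {x | x.1 a ≠ 0} := by
    intro a
    refine continuous_snd.comp_continuousOn
      ((Z.localTriv a).continuousOn_toFun.comp s.continuous.continuousOn fun x hx => ?_)
    rw [(Z.localTriv a).source_eq, Set.mem_preimage, hs']
    exact hx
  have hfab : ∀ a b (x : realization D), x.1 a ≠ 0 → x.1 b ≠ 0 → f b x = f a x + c a b := by
    intro a b x ha hb
    let q : ZMod 2 := (s x).2
    have h1 : ∀ v, f v x = q + c (i x) v := by
      intro v
      have := hs' x
      change q + c (i (s x).1) v = _
      rw [show (s x).1 = x from this]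
    rw [h1, h1, ← hc (i x) a b (mem_of_forall_ne_zero hD x.2 (by simp) ?_), add_assoc]
    intro v hv
    simp only [Finset.mem_insert, Finset.mem_singleton] at hv
    rcases hv with rfl | rfl | rfl
    exacts [hi x, ha, hb]
  refine ⟨fun a => if h : {a} ∈ D then f a ⟨_, mem_realization_single h⟩ else 0, fun a b hab => ?_⟩
  have ha : {a} ∈ D := hD.2 _ hab _ (by simp) (by simp)
  have hb : {b} ∈ D := hD.2 _ hab _ (by simp) (by simp)
  simp only [ha, hb, dif_pos]
  by_cases hne : a = b
  · subst hne
    simp [hc0]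
  let ψ : Set.Icc (0 : ℝ) 1 → realization D := fun t =>
    ⟨Pi.single a (1 - (t : ℝ)) + Pi.single b (t : ℝ), mem_realization_pair hne hab t.2.1 t.2.2⟩
  have hψa : ∀ t, (ψ t).1 a = 1 - t := fun t => by simp [ψ, hne]
  have hψb : ∀ t, (ψ t).1 b = t := fun t => by simp [ψ, Ne.symm hne]
  have hψc : Continuous ψ := by
    refine Continuous.subtype_mk (continuous_pi fun u => ?_) _
    simp only [Pi.add_apply, Pi.single_apply]
    refine Continuous.add ?_ ?_ <;> split_ifs <;> fun_prop
  have hψ0 : ψ 0 = ⟨_, mem_realization_single ha⟩ := by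
    ext u
    simp [ψ]
  have hψ1 : ψ 1 = ⟨_, mem_realization_single hb⟩ := by
    ext u
    simp [ψ]
  let m : Set.Icc (0 : ℝ) 1 := ⟨1 / 2, by norm_num, by norm_num⟩
  have hfa : f a (ψ 0) = f a (ψ m) := by
    refine (isPreconnected_Iic (a := m)).constant (f := f a ∘ ψ)
      ((hfc a).comp hψc.continuousOn fun t ht => ?_) (show (0 : Set.Icc (0 : ℝ) 1) ≤ m from m.2.1)
      (le_refl m)
    have : (t : ℝ) ≤ 1 / 2 := ht
    rw [Set.mem_ofPred_eq, hψa]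
    linarith
  have hfb : f b (ψ 1) = f b (ψ m) := by
    refine (isPreconnected_Ici (a := m)).constant (f := f b ∘ ψ)
      ((hfc b).comp hψc.continuousOn fun t ht => ?_) (show m ≤ (1 : Set.Icc (0 : ℝ) 1) from m.2.2)
      (le_refl m)
    have : 1 / 2 ≤ (t : ℝ) := ht
    rw [Set.mem_ofPred_eq, hψb]
    linarith
  rw [← hψ0, ← hψ1, hfa, hfb, hfab a b (ψ m) (by rw [hψa]; norm_num [m])
    (by rw [hψb]; norm_num [m])]
  ring

/-! ### Chains modulo two -/

/-- The boundary of a two-dimensional chain modulo two. -/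
noncomputable def faceBoundary (K : Finset (Finset V)) (r : Finset V → ZMod 2)
    (e : Finset V) : ZMod 2 :=
  ∑ t ∈ K with t.card = 3 ∧ e ⊆ t, r t

/-- The boundary of a one-dimensional chain modulo two. -/
noncomputable def edgeBoundary (K : Finset (Finset V)) (z : Finset V → ZMod 2) (v : V) : ZMod 2 :=
  ∑ e ∈ K with e.card = 2 ∧ v ∈ e, z e

/-- The combinatorial properties of triangulations of the disk that are needed for collapsing. -/
structure IsDiskLike (K : Finset (Finset V)) : Prop where
  isComplex : IsComplex (K : Set (Finset V))
  mem_of_adj : ∀ (A : Set V) (a₀ : V), a₀ ∈ A → {a₀} ∈ K → (∀ a ∈ A, ∀ b, {a, b} ∈ K → b ∈ A) →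
    ∀ b, {b} ∈ K → b ∈ A
  mem_of_link_adj : ∀ (v : V) (A : Set V) (a₀ : V), v ≠ a₀ → a₀ ∈ A → {v, a₀} ∈ K →
    (∀ a ∈ A, a ≠ v → ∀ b, b ≠ v → {v, a, b} ∈ K → b ∈ A) → ∀ b, v ≠ b → {v, b} ∈ K → b ∈ A
  eq_zero_of_faceBoundary : ∀ r : Finset V → ZMod 2,
    (∀ e ∈ K, e.card = 2 → faceBoundary K r e = 0) → ∀ t ∈ K, t.card = 3 → r t = 0
  not_three : ∀ a b c d e : V, a ≠ b → a ≠ c → b ≠ c → a ≠ d → b ≠ d → c ≠ d → a ≠ e → b ≠ e →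
    c ≠ e → d ≠ e → {a, b, c} ∈ K → {a, b, d} ∈ K → {a, b, e} ∉ K
  exists_faceBoundary : ∀ z : Finset V → ZMod 2, (∀ v, edgeBoundary K z v = 0) →
    ∃ r, ∀ e ∈ K, e.card = 2 → faceBoundary K r e = z e

lemma filter_pair_subset_triple {K : Finset (Finset V)} (hK : IsComplex (K : Set (Finset V)))
    {a b c : V} (hab : a ≠ b) (hac : a ≠ c) (hbc : b ≠ c) (h : {a, b, c} ∈ K) :
    {e ∈ K | e.card = 2 ∧ e ⊆ {a, b, c}} = {{a, b}, {b, c}, {a, c}} := by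
  ext e
  simp only [Finset.mem_filter, Finset.mem_insert, Finset.mem_singleton]
  constructor
  · rintro ⟨-, hc, hs⟩
    obtain ⟨x, y, hxy, rfl⟩ := Finset.card_eq_two.mp hc
    have hx := hs (Finset.mem_insert_self x {y})
    have hy := hs (Finset.mem_insert_of_mem (Finset.mem_singleton_self y))
    simp only [Finset.mem_insert, Finset.mem_singleton] at hx hy
    rcases hx with rfl | rfl | rfl <;> rcases hy with rfl | rfl | rfl <;>
      simp_all [Finset.pair_comm]
  · have key : ∀ x y, x ≠ y → ({x, y} : Finset V) ⊆ {a, b, c} →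
        ({x, y} : Finset V) ∈ K ∧ ({x, y} : Finset V).card = 2 ∧ ({x, y} : Finset V) ⊆ {a, b, c} :=
      fun x y hxy hs => ⟨hK.2 _ h _ hs (by simp), Finset.card_pair hxy, hs⟩
    rintro (rfl | rfl | rfl)
    · exact key _ _ hab (by simp [Finset.insert_subset_iff])
    · exact key _ _ hbc (by simp)
    · exact key _ _ hac (by simp [Finset.insert_subset_iff])

lemma edgeBoundary_faceBoundary {K : Finset (Finset V)} (hK : IsComplex (K : Set (Finset V)))
    (r : Finset V → ZMod 2) (v : V) : edgeBoundary K (faceBoundary K r) v = 0 := by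
  simp only [edgeBoundary, faceBoundary]
  rw [Finset.sum_comm' (t' := {t ∈ K | t.card = 3})
    (s' := fun t => {e ∈ K | (e.card = 2 ∧ e ⊆ t) ∧ v ∈ e})
    (by intro x y; simp only [Finset.mem_filter]; tauto)]
  refine Finset.sum_eq_zero fun t ht => ?_
  rw [Finset.mem_filter] at ht
  obtain ⟨a, b, c, hab, hac, hbc, rfl⟩ := Finset.card_eq_three.mp ht.2
  rw [← Finset.filter_filter, filter_pair_subset_triple hK hab hac hbc ht.1, Finset.sum_const]
  have h1 : ({a, b} : Finset V) ≠ {b, c} := fun h => by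
    have : a ∈ ({b, c} : Finset V) := h ▸ by simp
    simp [hab, hac] at this
  have h2 : ({a, b} : Finset V) ≠ {a, c} := fun h => by
    have : b ∈ ({a, c} : Finset V) := h ▸ by simp
    simp [hab.symm, hbc] at this
  have h3 : ({b, c} : Finset V) ≠ {a, c} := fun h => by
    have : b ∈ ({a, c} : Finset V) := h ▸ by simp
    simp [hab.symm, hbc] at this
  have h4 : (2 : ZMod 2) = 0 := rfl
  by_cases ha : v = a
  · subst ha
    simp [Finset.filter_insert, Finset.filter_singleton, hab, hac, h2, h4]
  by_cases hb : v = b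
  · subst hb
    simp [Finset.filter_insert, Finset.filter_singleton, ha, hbc, h1, h4]
  by_cases hc : v = c
  · subst hc
    simp [Finset.filter_insert, Finset.filter_singleton, ha, hb, h3, h4]
  · simp [Finset.filter_insert, Finset.filter_singleton, ha, hb, hc]

/-- On a complex whose one-cocycles are coboundaries, every one-cycle is a boundary. -/
lemma exists_faceBoundary_eq {K : Finset (Finset V)} (hK : IsComplex (K : Set (Finset V)))
    (hH : ∀ c : V → V → ZMod 2, (∀ a, c a a = 0) →
      (∀ a b d, {a, b, d} ∈ K → c a b + c b d = c a d) →
      ∃ g : V → ZMod 2, ∀ a b, {a, b} ∈ K → c a b = g b - g a)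
    {z : Finset V → ZMod 2} (hz : ∀ v, edgeBoundary K z v = 0) :
    ∃ r, ∀ e ∈ K, e.card = 2 → faceBoundary K r e = z e := by
  let B : (Finset V → ZMod 2) →ₗ[ZMod 2] (Finset V → ZMod 2) :=
    { toFun := fun r e => if e ∈ K ∧ e.card = 2 then faceBoundary K r e else 0
      map_add' := fun r s => by
        ext e
        simp only [faceBoundary, Pi.add_apply]
        split_ifs <;> simp [Finset.sum_add_distrib]
      map_smul' := fun k r => by
        ext e
        simp only [faceBoundary, Pi.smul_apply, smul_eq_mul, RingHom.id_apply]
        split_ifs <;> simp [Finset.mul_sum] }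
  let z' : Finset V → ZMod 2 := fun e => if e ∈ K ∧ e.card = 2 then z e else 0
  by_cases hmem : z' ∈ LinearMap.range B
  · obtain ⟨r, hr⟩ := hmem
    refine ⟨r, fun e he hc => ?_⟩
    have := congrFun hr e
    simpa [B, z', he, hc] using this
  exfalso
  obtain ⟨f, hfz, hf⟩ := Submodule.exists_le_ker_of_notMem hmem
  let φ : Finset V → ZMod 2 := fun e => f (Pi.single e 1)
  have hfφ : ∀ y : Finset V → ZMod 2,
      f (fun e => if e ∈ K ∧ e.card = 2 then y e else 0) = ∑ e ∈ K with e.card = 2, y e * φ e := by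
    intro y
    have : (fun e => if e ∈ K ∧ e.card = 2 then y e else 0) =
        ∑ e ∈ K with e.card = 2, y e • (Pi.single e 1 : Finset V → ZMod 2) := by
      ext e
      simp only [Finset.sum_apply, Pi.smul_apply, Pi.single_apply, smul_eq_mul, mul_ite, mul_one,
        mul_zero, Finset.sum_ite_eq, Finset.mem_filter]
    rw [this, map_sum]
    simp [φ]
  have htri : ∀ a b d, a ≠ b → a ≠ d → b ≠ d → ({a, b, d} : Finset V) ∈ K →
      φ {a, b} + φ {b, d} + φ {a, d} = 0 := by
    intro a b d hab had hbd h
    have h0 : f (B (Pi.single {a, b, d} 1)) = 0 := hf ⟨_, rfl⟩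
    have hB : B (Pi.single {a, b, d} 1) = fun e => if e ∈ K ∧ e.card = 2 then
        (if e ⊆ {a, b, d} then 1 else 0) else 0 := by
      ext e
      have : faceBoundary K (Pi.single {a, b, d} 1) e = if e ⊆ {a, b, d} then 1 else 0 := by
        have h3 : ({a, b, d} : Finset V).card = 3 := Finset.card_eq_three.mpr
          ⟨a, b, d, hab, had, hbd, rfl⟩
        simp only [faceBoundary, Pi.single_apply, Finset.sum_ite_eq', Finset.mem_filter, h, h3,
          true_and]
      simp only [B, LinearMap.coe_mk, AddHom.coe_mk, this]
    rw [hB, hfφ] at h0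
    simp only [ite_mul, one_mul, zero_mul] at h0
    rw [← Finset.sum_filter, Finset.filter_filter, filter_pair_subset_triple hK hab had hbd h,
      Finset.sum_insert, Finset.sum_insert, Finset.sum_singleton, ← add_assoc] at h0
    · exact h0
    · rw [Finset.mem_singleton]
      intro h
      have : b ∈ ({a, d} : Finset V) := h ▸ by simp
      simp [hab.symm, hbd] at this
    · simp only [Finset.mem_insert, Finset.mem_singleton]
      rintro (h | h)
      · have : a ∈ ({b, d} : Finset V) := h ▸ by simp
        simp [hab, had] at this
      · have : b ∈ ({a, d} : Finset V) := h ▸ by simp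
        simp [hab.symm, hbd] at this
  obtain ⟨g, hg⟩ := hH (fun a b => if a = b then 0 else φ {a, b}) (fun a => by simp) (by
    intro a b d h
    by_cases hab : a = b
    · simp [hab]
    by_cases hbd : b = d
    · simp [hbd]
    by_cases had : a = d
    · subst had
      simp [hab, hbd, Finset.pair_comm b a, CharTwo.add_self_eq_zero]
    · have := htri a b d hab had hbd h
      simp only [hab, hbd, had, if_false]
      exact CharTwo.add_eq_zero.mp this)
  apply hfz
  rw [hfφ]
  have hφ : ∀ e ∈ K, e.card = 2 → φ e = ∑ v ∈ e, g v := by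
    intro e he hc
    obtain ⟨a, b, hab, rfl⟩ := Finset.card_eq_two.mp hc
    have := hg a b he
    rw [if_neg hab] at this
    rw [this, Finset.sum_pair hab, CharTwo.sub_eq_add, add_comm]
  calc ∑ e ∈ K with e.card = 2, z e * φ e
      = ∑ e ∈ K with e.card = 2, ∑ v ∈ e, z e * g v := by
        refine Finset.sum_congr rfl fun e he => ?_
        rw [Finset.mem_filter] at he
        rw [hφ e he.1 he.2, Finset.mul_sum]
    _ = ∑ v ∈ K.biUnion id, ∑ e ∈ K with e.card = 2 ∧ v ∈ e, z e * g v := by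
        refine Finset.sum_comm' fun e v => ?_
        simp only [Finset.mem_filter, Finset.mem_biUnion, id]
        constructor
        · rintro ⟨⟨h1, h2⟩, h3⟩
          exact ⟨⟨h1, h2, h3⟩, e, h1, h3⟩
        · rintro ⟨⟨h1, h2, h3⟩, -⟩
          exact ⟨⟨h1, h2⟩, h3⟩
    _ = 0 := by
        refine Finset.sum_eq_zero fun v _ => ?_
        rw [← Finset.sum_mul]
        have := hz v
        rw [edgeBoundary] at this
        rw [this, zero_mul]

/-- A complex whose realization is a closed disk has the combinatorial properties of a disk. -/
lemma isDiskLike_of_homeomorph {K : Finset (Finset V)} (hK : IsComplex (K : Set (Finset V)))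
    (h : realization K ≃ₜ Metric.closedBall (0 : ℂ) 1) : IsDiskLike K := by
  have hconv : Convex ℝ (Metric.closedBall (0 : ℂ) 1) := convex_closedBall _ _
  have : ContractibleSpace (Metric.closedBall (0 : ℂ) 1) :=
    Metric.contractibleSpace_closedBall zero_le_one
  have : ContractibleSpace (realization K) := h.contractibleSpace
  have : LocallyPathConnectedSpace (Metric.closedBall (0 : ℂ) 1) :=
    hconv.locallyPathConnectedSpace
  have : LocallyPathConnectedSpace (realization K) :=
    h.symm.isQuotientMap.locallyPathConnectedSpace
  let j : (V → ℝ) → ℂ := fun w => if hw : w ∈ realization K then h ⟨w, hw⟩ else 0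
  have hjw : ∀ w (hw : w ∈ realization K), j w = h ⟨w, hw⟩ := fun w hw => dif_pos hw
  have hj : ContinuousOn j (realization K) := by
    rw [continuousOn_iff_continuous_domRestrict]
    have : (realization K).domRestrict j = fun w => (h w : ℂ) := by
      ext w
      exact hjw _ w.2
    rw [this]
    fun_prop
  have hinj : Set.InjOn j (realization K) := by
    intro x hx y hy hxy
    rw [hjw x hx, hjw y hy] at hxy
    exact congrArg Subtype.val (h.injective (Subtype.ext hxy))
  have hloc : ∀ x : realization K, ∀ U ∈ nhds x, ∃ W ∈ nhds x, W ⊆ U ∧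
      IsPreconnected (W \ {x}) := by
    intro x U hU
    obtain ⟨W, hW, hWU, hpre⟩ := closedBall_exists_nhds_isPreconnected_diff (h x) (h '' U)
      (h.isOpenMap.image_mem_nhds hU)
    refine ⟨h ⁻¹' W, h.continuous.continuousAt hW, fun y hy => ?_, ?_⟩
    · obtain ⟨u, hu, huy⟩ := hWU hy
      rwa [← h.injective huy]
    · have : h ⁻¹' W \ {x} = h ⁻¹' (W \ {h x}) := by
        ext y
        simp
      rw [this]
      exact h.isPreconnected_preimage.mpr hpre
  refine ⟨hK, fun A a₀ h1 h2 h3 b hb => mem_of_closed_under_adj hK h1 h2 h3 hb,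
    fun v A a₀ h1 h2 h3 h4 b h5 h6 => mem_of_closed_under_link_adj hK hloc h1 h2 h3 h4 h5 h6,
    ?_, fun a b c d e h1 h2 h3 h4 h5 h6 h7 h8 h9 h10 h11 h12 h13 =>
      not_three_triangles hj hinj h1 h2 h3 h4 h5 h6 h7 h8 h9 h10 h11 h12 h13,
    fun z hz => exists_faceBoundary_eq hK (exists_eq_sub_of_cocycle hK) hz⟩
  intro r hr t ht htc
  by_contra hrt
  let S : Finset (Finset V) := {t ∈ K | t.card = 3 ∧ r t ≠ 0}
  have hS : realization S ⊆ realization K := realization_mono (Finset.filter_subset _ _)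
  refine not_closed_surface (S := S) (hj.mono hS) (hinj.mono hS)
    ⟨t, Finset.mem_filter.mpr ⟨ht, htc, hrt⟩⟩ (fun t ht => (Finset.mem_filter.mp ht).2.1) ?_
  intro t ht e het hec
  obtain ⟨htK, htc, hrt⟩ := Finset.mem_filter.mp ht
  by_contra! hcon
  have he0 := hr e (hK.2 t htK e het (by rintro rfl; simp at hec)) hec
  rw [faceBoundary, Finset.sum_eq_single t] at he0
  · exact hrt he0
  · intro t' ht' hne
    obtain ⟨h1, h2, h3⟩ := Finset.mem_filter.mp ht'
    by_contra h0
    exact hcon t' (Finset.mem_filter.mpr ⟨h1, h2, h0⟩) hne h3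
  · intro h
    exact absurd (Finset.mem_filter.mpr ⟨htK, htc, het⟩) h

/-! ### Geometric complexes -/

lemma isComplex_faces {E : Type*} [AddCommGroup E] [Module ℝ E]
    (D : Geometry.SimplicialComplex ℝ E) : IsComplex D.faces :=
  ⟨fun _ hσ => (D.nonempty_of_mem_faces hσ).ne_empty, fun _ hσ _ hτσ hτ =>
    D.down_closed hσ hτσ (Finset.nonempty_iff_ne_empty.mpr hτ)⟩

/-- Barycentric coordinates in a common face. -/
lemma eq_of_sum_smul_eq {E : Type*} [AddCommGroup E] [Module ℝ E]
    (D : Geometry.SimplicialComplex ℝ E) {σ σ' : Finset E} (hσ : σ ∈ D.faces) (hσ' : σ' ∈ D.faces)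
    {w w' : E → ℝ} (hw0 : ∀ v, 0 ≤ w v) (hw0' : ∀ v, 0 ≤ w' v)
    (hwz : ∀ v ∉ σ, w v = 0) (hwz' : ∀ v ∉ σ', w' v = 0)
    (hw1 : ∑ v ∈ σ, w v = 1) (hw1' : ∑ v ∈ σ', w' v = 1)
    (h : ∑ v ∈ σ, w v • v = ∑ v ∈ σ', w' v • v) : w = w' := by
  have hx : ∑ v ∈ σ, w v • v ∈ convexHull ℝ ((σ ∩ σ' : Finset E) : Set E) := by
    rw [Finset.coe_inter]
    refine D.inter_subset_convexHull hσ hσ' ⟨?_, ?_⟩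
    · exact Finset.mem_convexHull'.mpr ⟨w, fun v _ => hw0 v, hw1, rfl⟩
    · exact Finset.mem_convexHull'.mpr ⟨w', fun v _ => hw0' v, hw1', h.symm⟩
  obtain ⟨u, -, hu1, hux⟩ := Finset.mem_convexHull'.mp hx
  let u' : E → ℝ := fun v => if v ∈ σ ∩ σ' then u v else 0
  have key : ∀ (τ : Finset E) (y : E → ℝ), τ ∈ D.faces → σ ∩ σ' ⊆ τ → (∀ v ∉ τ, y v = 0) →
      ∑ v ∈ τ, y v = 1 → ∑ v ∈ τ, y v • v = ∑ v ∈ σ, w v • v → y = u' := by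
    intro τ y hτ hsub hz h1 hs
    have e1 : ∑ v ∈ τ, u' v = ∑ v ∈ σ ∩ σ', u v := by
      simp only [u', Finset.sum_ite_mem, Finset.inter_eq_right.mpr hsub]
    have e2 : ∑ v ∈ τ, u' v • v = ∑ v ∈ σ ∩ σ', u v • v := by
      simp only [u', ite_smul, zero_smul, Finset.sum_ite_mem, Finset.inter_eq_right.mpr hsub]
    have := (D.indep hτ).eq_of_sum_eq_sum_subtype (w₁ := y) (w₂ := u') (by rw [e1, hu1, h1])
      (by rw [e2, hux, hs])
    funext v
    by_cases hv : v ∈ τ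
    · exact this v hv
    · rw [hz v hv]
      exact (if_neg fun h => hv (hsub h)).symm
  rw [key σ w hσ Finset.inter_subset_left hwz hw1 rfl,
    key σ' w' hσ' Finset.inter_subset_right hwz' hw1' h.symm]

/-- The space of a finite geometric complex is homeomorphic to its realization. -/
lemma nonempty_realization_homeomorph {E : Type*} [AddCommGroup E] [Module ℝ E]
    [TopologicalSpace E] [T2Space E] [ContinuousAdd E] [ContinuousSMul ℝ E]
    (D : Geometry.SimplicialComplex ℝ E) (hfin : D.faces.Finite) :
    Nonempty (realization hfin.toFinset ≃ₜ D.space) := by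
  set K := hfin.toFinset with hK
  let Φ : (E → ℝ) → E := fun w => ∑ v ∈ K.biUnion id, w v • v
  have hΦ : ∀ w σ, σ ∈ K → (∀ v ∉ σ, w v = 0) → Φ w = ∑ v ∈ σ, w v • v := by
    intro w σ hσ hz
    refine (Finset.sum_subset (fun v hv => Finset.mem_biUnion.mpr ⟨σ, hσ, hv⟩) ?_).symm
    intro v _ hv
    rw [hz v hv, zero_smul]
  have hmaps : ∀ w ∈ realization K, Φ w ∈ D.space := by
    rintro w ⟨h0, σ, hσ, hz, h1⟩
    rw [hΦ w σ hσ hz]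
    exact D.convexHull_subset_space (hfin.mem_toFinset.mp hσ)
      (Finset.mem_convexHull'.mpr ⟨w, fun v _ => h0 v, h1, rfl⟩)
  have hbij : Function.Bijective (fun w : realization K => (⟨Φ w, hmaps w w.2⟩ : D.space)) := by
    constructor
    · rintro ⟨w, h0, σ, hσ, hz, h1⟩ ⟨w', h0', σ', hσ', hz', h1'⟩ h
      have h : Φ w = Φ w' := congrArg Subtype.val h
      rw [hΦ w σ hσ hz, hΦ w' σ' hσ' hz'] at h
      exact Subtype.ext (eq_of_sum_smul_eq D (hfin.mem_toFinset.mp hσ) (hfin.mem_toFinset.mp hσ')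
        h0 h0' hz hz' h1 h1' h)
    · rintro ⟨x, hx⟩
      obtain ⟨σ, hσ, hxσ⟩ := D.mem_space_iff.mp hx
      obtain ⟨w, h0, h1, hw⟩ := Finset.mem_convexHull'.mp hxσ
      have hσK : σ ∈ K := hfin.mem_toFinset.mpr hσ
      let w' : E → ℝ := fun v => if v ∈ σ then w v else 0
      have hz : ∀ v ∉ σ, w' v = 0 := fun v hv => if_neg hv
      have hw' : ∀ v ∈ σ, w' v = w v := fun v hv => if_pos hv
      refine ⟨⟨w', fun v => ?_, σ, hσK, hz, ?_⟩, Subtype.ext ?_⟩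
      · by_cases hv : v ∈ σ
        · rw [hw' v hv]
          exact h0 v hv
        · rw [hz v hv]
      · rw [← h1]
        exact Finset.sum_congr rfl hw'
      · change Φ w' = x
        rw [hΦ w' σ hσK hz, ← hw]
        exact Finset.sum_congr rfl fun v hv => by rw [hw' v hv]
  have hcont : Continuous (fun w : realization K => (⟨Φ w, hmaps w w.2⟩ : D.space)) := by
    refine Continuous.subtype_mk (continuous_finsetSum _ fun v _ => ?_) _
    exact ((continuous_apply v).comp continuous_subtype_val).smul continuous_const
  have : CompactSpace (realization K) := isCompact_iff_compactSpace.mp (isCompact_realization K)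
  exact ⟨Continuous.homeoOfEquivCompactToT2 (f := Equiv.ofBijective _ hbij) hcont⟩

/-- A triangulated disk has the combinatorial properties of a disk. -/
lemma isDiskLike_toFinset_faces {N : ℕ}
    (D : Geometry.SimplicialComplex ℝ (EuclideanSpace ℝ (Fin N))) (hfin : D.faces.Finite)
    (hdisk : IsBallSet 2 D.space) : IsDiskLike hfin.toFinset := by
  obtain ⟨h₁⟩ := nonempty_realization_homeomorph D hfin
  obtain ⟨h₂⟩ := hdisk
  let e := Complex.orthonormalBasisOneI.repr.symm
  have he : e '' Metric.closedBall 0 1 = Metric.closedBall (0 : ℂ) 1 := by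
    rw [LinearIsometryEquiv.image_closedBall, map_zero]
  refine isDiskLike_of_homeomorph ?_ ((h₁.trans h₂).trans
    ((e.toHomeomorph.image _).trans (Homeomorph.setCongr he)))
  rw [hfin.coe_toFinset]
  exact isComplex_faces D

/-! ### Calculus of chains -/

lemma zmod_two_eq_one {x : ZMod 2} (hx : x ≠ 0) : x = 1 := by
  revert x
  decide

lemma faceBoundary_add (K : Finset (Finset V)) (r s : Finset V → ZMod 2) (e : Finset V) :
    faceBoundary K (r + s) e = faceBoundary K r e + faceBoundary K s e := by
  simp [faceBoundary, Finset.sum_add_distrib]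

lemma edgeBoundary_add (K : Finset (Finset V)) (y z : Finset V → ZMod 2) (v : V) :
    edgeBoundary K (y + z) v = edgeBoundary K y v + edgeBoundary K z v := by
  simp [edgeBoundary, Finset.sum_add_distrib]

lemma faceBoundary_single {K : Finset (Finset V)} {t : Finset V} (ht : t ∈ K) (htc : t.card = 3)
    (k : ZMod 2) (e : Finset V) :
    faceBoundary K (Pi.single t k) e = if e ⊆ t then k else 0 := by
  simp only [faceBoundary, Pi.single_apply, Finset.sum_ite_eq', Finset.mem_filter, ht, htc,
    true_and]

lemma edgeBoundary_single_pair {K : Finset (Finset V)} {a b : V} (hab : a ≠ b)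
    (h : {a, b} ∈ K) (v : V) :
    edgeBoundary K (Pi.single {a, b} 1) v = (if v = a then 1 else 0) + if v = b then 1 else 0 := by
  simp only [edgeBoundary, Pi.single_apply, Finset.sum_ite_eq', Finset.mem_filter, h,
    Finset.card_pair hab, true_and, Finset.mem_insert, Finset.mem_singleton]
  by_cases h1 : v = a
  · subst h1
    simp [hab]
  · simp [h1]

lemma exists_ne_zero_of_faceBoundary_ne_zero {K : Finset (Finset V)} {r : Finset V → ZMod 2}
    {e : Finset V} (h : faceBoundary K r e ≠ 0) : ∃ t ∈ K, t.card = 3 ∧ e ⊆ t ∧ r t ≠ 0 := by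
  obtain ⟨t, ht, hrt⟩ := Finset.exists_ne_zero_of_sum_ne_zero h
  obtain ⟨h1, h2, h3⟩ := Finset.mem_filter.mp ht
  exact ⟨t, h1, h2, h3, hrt⟩

lemma exists_ne_of_faceBoundary_eq_zero {K : Finset (Finset V)} {r : Finset V → ZMod 2}
    {e t : Finset V} (h : faceBoundary K r e = 0) (ht : t ∈ K) (htc : t.card = 3) (het : e ⊆ t)
    (hrt : r t ≠ 0) : ∃ t' ∈ K, t'.card = 3 ∧ e ⊆ t' ∧ t' ≠ t := by
  by_contra! hcon
  rw [faceBoundary, Finset.sum_eq_single t] at h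
  · exact hrt h
  · intro t' ht' hne
    obtain ⟨h1, h2, h3⟩ := Finset.mem_filter.mp ht'
    exact absurd (hcon t' h1 h2 h3) hne
  · intro h'
    exact absurd (Finset.mem_filter.mpr ⟨ht, htc, het⟩) h'

lemma eq_insert_of_pair_subset {a b : V} (hab : a ≠ b) {t : Finset V} (htc : t.card = 3)
    (h : {a, b} ⊆ t) : ∃ c, a ≠ c ∧ b ≠ c ∧ t = {a, b, c} := by
  have hc : (t \ {a, b}).card = 1 := by
    rw [Finset.card_sdiff_of_subset h, htc, Finset.card_pair hab]
  obtain ⟨c, hc⟩ := Finset.card_eq_one.mp hc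
  have hct : c ∈ t \ {a, b} := hc ▸ Finset.mem_singleton_self c
  simp only [Finset.mem_sdiff, Finset.mem_insert, Finset.mem_singleton, not_or] at hct
  refine ⟨c, Ne.symm hct.2.1, Ne.symm hct.2.2, ?_⟩
  rw [← Finset.sdiff_union_of_subset h, hc]
  ext x
  simp only [Finset.mem_union, Finset.mem_insert, Finset.mem_singleton]
  tauto

namespace IsDiskLike

variable {K : Finset (Finset V)}

lemma faceBoundary_eq_add (hK : IsDiskLike K) (r : Finset V → ZMod 2) {e t t' : Finset V}
    (hec : e.card = 2) (ht : t ∈ K) (htc : t.card = 3) (het : e ⊆ t) (ht' : t' ∈ K)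
    (htc' : t'.card = 3) (het' : e ⊆ t') (hne : t ≠ t') : faceBoundary K r e = r t + r t' := by
  obtain ⟨a, b, hab, rfl⟩ := Finset.card_eq_two.mp hec
  obtain ⟨c, hac, hbc, rfl⟩ := eq_insert_of_pair_subset hab htc het
  obtain ⟨d, had, hbd, rfl⟩ := eq_insert_of_pair_subset hab htc' het'
  have hcd : c ≠ d := fun h => hne (by rw [h])
  have : {t ∈ K | t.card = 3 ∧ {a, b} ⊆ t} = {{a, b, c}, {a, b, d}} := by
    ext x
    simp only [Finset.mem_filter, Finset.mem_insert, Finset.mem_singleton]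
    constructor
    · rintro ⟨hx, hxc, hs⟩
      obtain ⟨u, hau, hbu, rfl⟩ := eq_insert_of_pair_subset hab hxc hs
      by_contra! hcon
      exact hK.not_three a b c d u hab hac hbc had hbd hcd hau hbu (fun h => hcon.1 (by rw [h]))
        (fun h => hcon.2 (by rw [h])) ht ht' hx
    · rintro (rfl | rfl)
      exacts [⟨ht, htc, het⟩, ⟨ht', htc', het'⟩]
  rw [faceBoundary, this, Finset.sum_pair hne]

lemma faceBoundary_mul (hK : IsDiskLike K) {r s : Finset V → ZMod 2} {e : Finset V}
    (hec : e.card = 2) (hr : faceBoundary K r e = 0) (hs : faceBoundary K s e = 0) :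
    faceBoundary K (r * s) e = 0 := by
  by_contra h
  obtain ⟨t, ht, htc, het, hrs⟩ := exists_ne_zero_of_faceBoundary_ne_zero h
  have hrt : r t ≠ 0 := left_ne_zero_of_mul hrs
  obtain ⟨t', ht', htc', het', hne⟩ := exists_ne_of_faceBoundary_eq_zero hr ht htc het hrt
  have key := fun q => hK.faceBoundary_eq_add q hec ht htc het ht' htc' het' hne.symm
  rw [key] at hr hs h
  simp only [Pi.mul_apply] at h
  generalize r t = x at *
  generalize r t' = y at *
  generalize s t = z at *
  generalize s t' = w at *
  revert x y z w
  decide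

/-- A disk has dimension at most two. -/
lemma card_le_three (hK : IsDiskLike K) {σ : Finset V} (hσ : σ ∈ K) : σ.card ≤ 3 := by
  by_contra! hc
  obtain ⟨Q, hQσ, hQc⟩ := Finset.exists_subset_card_eq (show 4 ≤ σ.card from hc)
  have hface : ∀ τ ⊆ Q, τ.card ≠ 0 → τ ∈ K := fun τ hτ h0 =>
    hK.isComplex.2 σ hσ τ (hτ.trans hQσ) (by rintro rfl; exact h0 rfl)
  let r : Finset V → ZMod 2 := fun t => if t ⊆ Q then 1 else 0
  have hr : ∀ e ∈ K, e.card = 2 → faceBoundary K r e = 0 := by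
    intro e _ hec
    by_cases heQ : e ⊆ Q
    · have h2 : (Q \ e).card = 2 := by rw [Finset.card_sdiff_of_subset heQ, hQc, hec]
      obtain ⟨x, y, hxy, h⟩ := Finset.card_eq_two.mp h2
      have hx : x ∈ Q \ e := h ▸ by simp
      have hy : y ∈ Q \ e := h ▸ by simp
      rw [Finset.mem_sdiff] at hx hy
      have hxQ : insert x e ⊆ Q := Finset.insert_subset hx.1 heQ
      have hyQ : insert y e ⊆ Q := Finset.insert_subset hy.1 heQ
      have hxc : (insert x e).card = 3 := by rw [Finset.card_insert_of_notMem hx.2, hec]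
      have hyc : (insert y e).card = 3 := by rw [Finset.card_insert_of_notMem hy.2, hec]
      rw [hK.faceBoundary_eq_add r hec (hface _ hxQ (by omega)) hxc (Finset.subset_insert _ _)
        (hface _ hyQ (by omega)) hyc (Finset.subset_insert _ _) ?_]
      · simp only [r, hxQ, hyQ, if_true]
        rfl
      · intro h
        have := h ▸ Finset.mem_insert_self x e
        simp [hxy, hx.2] at this
    · by_contra h
      obtain ⟨t, -, -, het, ht⟩ := exists_ne_zero_of_faceBoundary_ne_zero h
      exact ht (if_neg fun htQ => heQ (het.trans htQ))
  obtain ⟨t, htQ, htc⟩ := Finset.exists_subset_card_eq (show 3 ≤ Q.card by omega)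
  have := hK.eq_zero_of_faceBoundary r hr t (hface t htQ (by omega)) htc
  simp [r, htQ] at this

end IsDiskLike

/-! ### Growing a subcomplex of a disk -/

/-- Two vertices are joined by a chain of edges of `L` modulo two. -/
def ChainJoined (K L : Finset (Finset V)) (a b : V) : Prop :=
  ∃ z : Finset V → ZMod 2, (∀ e ∉ L, z e = 0) ∧
    ∀ v, edgeBoundary K z v = (if v = a then 1 else 0) + if v = b then 1 else 0

lemma ChainJoined.mono {K L L' : Finset (Finset V)} (h : L ⊆ L') {a b : V} :
    ChainJoined K L a b → ChainJoined K L' a b := fun ⟨z, hz, hb⟩ =>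
  ⟨z, fun e he => hz e fun h' => he (h h'), hb⟩

lemma ChainJoined.symm {K L : Finset (Finset V)} {a b : V} :
    ChainJoined K L a b → ChainJoined K L b a := fun ⟨z, hz, hb⟩ =>
  ⟨z, hz, fun v => by rw [hb, add_comm]⟩

lemma ChainJoined.refl {K L : Finset (Finset V)} (a : V) : ChainJoined K L a a :=
  ⟨0, fun _ _ => rfl, fun v => by simp [edgeBoundary, CharTwo.add_self_eq_zero]⟩

lemma ChainJoined.trans {K L : Finset (Finset V)} {a b c : V} :
    ChainJoined K L a b → ChainJoined K L b c → ChainJoined K L a c := by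
  rintro ⟨y, hy, hyb⟩ ⟨z, hz, hzb⟩
  refine ⟨y + z, fun e he => by simp [hy e he, hz e he], fun v => ?_⟩
  rw [edgeBoundary_add, hyb, hzb, add_assoc, ← add_assoc (if v = b then (1 : ZMod 2) else 0),
    CharTwo.add_self_eq_zero, zero_add]

lemma ChainJoined.of_mem {K L : Finset (Finset V)} {a b : V} (hab : a ≠ b) (hL : {a, b} ∈ L)
    (hK : {a, b} ∈ K) : ChainJoined K L a b :=
  ⟨Pi.single {a, b} 1, fun e he => by
    rw [Pi.single_apply, if_neg]
    rintro rfl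
    exact he hL, edgeBoundary_single_pair hab hK⟩

/-- The subcomplexes of a disk through which the collapse passes. -/
structure IsCore (K L : Finset (Finset V)) : Prop where
  subset : L ⊆ K
  isComplex : IsComplex (L : Set (Finset V))
  exists_vertex : ∃ a, {a} ∈ L
  exists_edge : ∀ a, {a} ∈ L → ∃ b, a ≠ b ∧ {a, b} ∈ L
  chainJoined : ∀ a b, {a} ∈ L → {b} ∈ L → ChainJoined K L a b
  eq_zero : ∀ r : Finset V → ZMod 2, (∀ e ∈ K, e ∉ L → e.card = 2 → faceBoundary K r e = 0) →
    ∀ t ∈ K, t ∉ L → t.card = 3 → r t = 0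

/-- The triangle `F` can be added to `L` by the inverse of a collapse through the face `σ`. -/
structure IsAttachable (K L : Finset (Finset V)) (F σ : Finset V) : Prop where
  mem : F ∈ K
  notMem : σ ∉ L
  card : F.card = 3
  subset : σ ⊆ F
  card_free : σ.card = 1 ∨ σ.card = 2
  mem_of_not_subset : ∀ τ ⊆ F, τ ≠ ∅ → ¬ σ ⊆ τ → τ ∈ L

/-- The complex obtained from `L` by adding `F` and its faces. -/
noncomputable def attach (L : Finset (Finset V)) (F : Finset V) : Finset (Finset V) :=
  L ∪ F.powerset.erase ∅

lemma mem_attach {L : Finset (Finset V)} {F τ : Finset V} :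
    τ ∈ attach L F ↔ τ ∈ L ∨ τ ≠ ∅ ∧ τ ⊆ F := by
  simp [attach]

lemma subset_attach (L : Finset (Finset V)) (F : Finset V) : L ⊆ attach L F :=
  Finset.subset_union_left

namespace IsAttachable

variable {K L : Finset (Finset V)} {F σ : Finset V}

lemma ne_empty (h : IsAttachable K L F σ) : σ ≠ ∅ := by
  rintro rfl
  simpa using h.card_free

lemma notMem_of_subset (h : IsAttachable K L F σ) (hL : IsComplex (L : Set (Finset V)))
    {τ : Finset V} (hτ : σ ⊆ τ) : τ ∉ L := fun hτL => h.notMem (hL.2 τ hτL σ hτ h.ne_empty)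

lemma elemCollapseVia (h : IsAttachable K L F σ) (hL : IsComplex (L : Set (Finset V))) :
    ElemCollapseVia (attach L F : Set (Finset V)) (L : Set (Finset V)) σ F := by
  have hF0 : F ≠ ∅ := by
    rintro rfl
    simpa using h.card
  have hFmem : F ∈ attach L F := mem_attach.mpr (Or.inr ⟨hF0, subset_rfl⟩)
  have key : ∀ τ ∈ attach L F, σ ⊆ τ → τ ⊆ F := fun τ hτ hστ =>
    ((mem_attach.mp hτ).resolve_left (h.notMem_of_subset hL hστ)).2
  refine ⟨mem_attach.mpr (Or.inr ⟨h.ne_empty, h.subset⟩), fun hfac => ?_, ⟨hFmem, fun τ hτ hFτ =>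
    hFτ.antisymm (key τ hτ (h.subset.trans hFτ))⟩, h.subset, fun G hG hσG =>
    hG.2 F hFmem (key G hG.1 hσG), ?_⟩
  · have := congrArg Finset.card (hfac.2 F hFmem h.subset)
    have := h.card
    have := h.card_free
    omega
  · ext τ
    simp only [Finset.mem_coe, Set.mem_ofPred_eq]
    refine ⟨fun hτ => ⟨subset_attach L F hτ, fun hστ => h.notMem_of_subset hL hστ hτ⟩, ?_⟩
    rintro ⟨hτ, hστ⟩
    rcases mem_attach.mp hτ with hτ | ⟨h0, hτF⟩
    · exact hτ
    · exact h.mem_of_not_subset τ hτF h0 hστ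

lemma elemCollapseIJ (h : IsAttachable K L F σ) (hL : IsComplex (L : Set (Finset V))) :
    ElemCollapseIJ (attach L F : Set (Finset V)) (L : Set (Finset V)) 2 0 ∨
      ElemCollapseIJ (attach L F : Set (Finset V)) (L : Set (Finset V)) 2 1 :=
  h.card_free.imp (fun hc => ⟨σ, F, h.elemCollapseVia hL, hc, h.card⟩)
    fun hc => ⟨σ, F, h.elemCollapseVia hL, hc, h.card⟩

lemma exists_faceBoundary_eq (h : IsAttachable K L F σ) (hK : IsDiskLike K)
    (hL : IsComplex (L : Set (Finset V))) {r : Finset V → ZMod 2}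
    (hr : ∀ e ∈ K, e ∉ attach L F → e.card = 2 → faceBoundary K r e = 0) :
    ∃ k, ∀ e ∈ K, e ∉ L → e.card = 2 → e ⊆ F → faceBoundary K r e = k := by
  have hσe : ∀ e ⊆ F, e ∉ L → e.card = 2 → σ ⊆ e := fun e heF heL hec => by
    by_contra hσ
    exact heL (h.mem_of_not_subset e heF (by rintro rfl; simp at hec) hσ)
  rcases h.card_free with hc | hc
  · obtain ⟨v, rfl⟩ := Finset.card_eq_one.mp hc
    have hvF : v ∈ F := by simpa using h.subset
    have hc2 : (F.erase v).card = 2 := by rw [Finset.card_erase_of_mem hvF, h.card]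
    obtain ⟨a, b, hab, hFe⟩ := Finset.card_eq_two.mp hc2
    have ha : a ∈ F.erase v := hFe ▸ by simp
    have hb : b ∈ F.erase v := hFe ▸ by simp
    rw [Finset.mem_erase] at ha hb
    have hF : F = {v, a, b} := by rw [← Finset.insert_erase hvF, hFe]
    have hvaF : ({v, a} : Finset V) ⊆ F := by simp [hF, Finset.insert_subset_iff]
    have hvbF : ({v, b} : Finset V) ⊆ F := by simp [hF, Finset.insert_subset_iff]
    have hvaK : ({v, a} : Finset V) ∈ K := hK.isComplex.2 F h.mem _ hvaF (by simp)
    have hvbK : ({v, b} : Finset V) ∈ K := hK.isComplex.2 F h.mem _ hvbF (by simp)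
    have hne : ({v, a} : Finset V) ≠ {v, b} := fun h' => by
      have : a ∈ ({v, b} : Finset V) := h' ▸ by simp
      simp [ha.1, hab] at this
    have hsum := edgeBoundary_faceBoundary hK.isComplex r v
    rw [edgeBoundary, ← Finset.sum_subset (s₁ := {{v, a}, {v, b}}), Finset.sum_pair hne] at hsum
    · refine ⟨faceBoundary K r {v, a}, fun e heK heL hec heF => ?_⟩
      have hve : v ∈ e := by simpa using hσe e heF heL hec
      obtain ⟨w, hw⟩ := Finset.card_eq_one.mp
        (show (e.erase v).card = 1 by rw [Finset.card_erase_of_mem hve, hec])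
      have hwe : w ∈ e.erase v := hw ▸ by simp
      have he : e = {v, w} := by rw [← Finset.insert_erase hve, hw]
      have hwF : w ∈ F := heF (Finset.mem_of_mem_erase hwe)
      rw [hF, Finset.mem_insert, Finset.mem_insert, Finset.mem_singleton] at hwF
      rcases hwF with rfl | rfl | rfl
      · simp at hwe
      · rw [he]
      · rw [he]
        exact (CharTwo.add_eq_zero.mp hsum).symm
    · simp [Finset.insert_subset_iff, hvaK, hvbK, Finset.card_pair ha.1.symm,
        Finset.card_pair hb.1.symm]
    · intro e he hne'
      obtain ⟨heK, hec, hve⟩ := Finset.mem_filter.mp he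
      refine hr e heK (fun heL => ?_) hec
      rcases mem_attach.mp heL with heL | ⟨-, heF⟩
      · exact h.notMem_of_subset hL (by simpa using hve) heL
      · obtain ⟨w, hw⟩ := Finset.card_eq_one.mp
          (show (e.erase v).card = 1 by rw [Finset.card_erase_of_mem hve, hec])
        have hwe : w ∈ e.erase v := hw ▸ by simp
        have he : e = {v, w} := by rw [← Finset.insert_erase hve, hw]
        have hwF : w ∈ F := heF (Finset.mem_of_mem_erase hwe)
        rw [hF, Finset.mem_insert, Finset.mem_insert, Finset.mem_singleton] at hwF
        apply hne'
        rcases hwF with rfl | rfl | rfl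
        · simp at hwe
        · simp [he]
        · simp [he]
  · refine ⟨faceBoundary K r σ, fun e heK heL hec heF => ?_⟩
    rw [Finset.eq_of_subset_of_card_le (hσe e heF heL hec) (by rw [hc, hec])]

lemma isCore (h : IsAttachable K L F σ) (hK : IsDiskLike K) (hL : IsCore K L) :
    IsCore K (attach L F) := by
  have hFK : ∀ τ ⊆ F, τ ≠ ∅ → τ ∈ K := fun τ hτ h0 => hK.isComplex.2 F h.mem τ hτ h0
  have hpair : ∀ x ∈ F, ∀ y ∈ F, ({x, y} : Finset V) ⊆ F ∧ ({x, y} : Finset V) ∈ attach L F :=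
    fun x hx y hy => by
      have hs : ({x, y} : Finset V) ⊆ F := by simp [Finset.insert_subset_iff, hx, hy]
      exact ⟨hs, mem_attach.mpr (Or.inr ⟨by simp, hs⟩)⟩
  obtain ⟨a, haF, haL⟩ : ∃ a ∈ F, ({a} : Finset V) ∈ L := by
    obtain ⟨a, ha, haσ⟩ := Finset.exists_mem_notMem_of_card_lt_card (s := σ) (t := F) (by
      have := h.card
      have := h.card_free
      omega)
    refine ⟨a, ha, h.mem_of_not_subset {a} (by simpa using ha) (by simp) fun hσ => ?_⟩
    rcases Finset.subset_singleton_iff.mp hσ with h0 | h0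
    · exact h.ne_empty h0
    · simp [h0] at haσ
  have hjoin : ∀ x, {x} ∈ attach L F → ChainJoined K (attach L F) x a := by
    intro x hx
    rcases mem_attach.mp hx with hx | ⟨-, hx⟩
    · exact (hL.chainJoined x a hx haL).mono (subset_attach L F)
    · rw [Finset.singleton_subset_iff] at hx
      by_cases hxa : x = a
      · subst hxa
        exact ChainJoined.refl x
      · obtain ⟨h1, h2⟩ := hpair x hx a haF
        exact ChainJoined.of_mem hxa h2 (hFK _ h1 (by simp))
  refine ⟨?_, ⟨?_, ?_⟩, ⟨a, subset_attach L F haL⟩, ?_, fun x y hx hy =>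
    (hjoin x hx).trans (hjoin y hy).symm, ?_⟩
  · intro τ hτ
    rcases mem_attach.mp hτ with hτ | ⟨h0, hτ⟩
    exacts [hL.subset hτ, hFK τ hτ h0]
  · intro τ hτ
    rcases mem_attach.mp hτ with hτ | ⟨h0, hτ⟩
    exacts [hL.isComplex.1 τ hτ, h0]
  · intro τ hτ ρ hρ h0
    rcases mem_attach.mp hτ with hτ | ⟨-, hτ⟩
    · exact subset_attach L F (hL.isComplex.2 τ hτ ρ hρ h0)
    · exact mem_attach.mpr (Or.inr ⟨h0, hρ.trans hτ⟩)
  · intro x hx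
    rcases mem_attach.mp hx with hx | ⟨-, hx⟩
    · obtain ⟨y, hxy, hy⟩ := hL.exists_edge x hx
      exact ⟨y, hxy, subset_attach L F hy⟩
    · rw [Finset.singleton_subset_iff] at hx
      obtain ⟨y, hy, hyx⟩ := Finset.exists_mem_ne (by rw [h.card]; norm_num : 1 < F.card) x
      exact ⟨y, hyx.symm, (hpair x hx y hy).2⟩
  · intro r hr t ht htL htc
    obtain ⟨k, hk⟩ := h.exists_faceBoundary_eq hK hL.isComplex hr
    have hs := hL.eq_zero (r + Pi.single F k) (fun e heK heL hec => by
      rw [faceBoundary_add, faceBoundary_single h.mem h.card]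
      by_cases heF : e ⊆ F
      · rw [if_pos heF, hk e heK heL hec heF, CharTwo.add_self_eq_zero]
      · rw [if_neg heF, add_zero]
        refine hr e heK (fun he => ?_) hec
        rcases mem_attach.mp he with he | ⟨-, he⟩
        exacts [heL he, heF he]) t ht (fun h' => htL (subset_attach L F h')) htc
    have htF : t ≠ F := by
      rintro rfl
      exact htL (mem_attach.mpr (Or.inr ⟨by rintro rfl; simp at htc, subset_rfl⟩))
    simpa [Pi.single_apply, htF] using hs

end IsAttachable

/-! ### Existence of attachable triangles -/

namespace IsCore

variable {K L : Finset (Finset V)}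

lemma vertex_mem (hL : IsCore K L) {a b : V} (h : {a, b} ∈ L) : {a} ∈ L ∧ {b} ∈ L :=
  ⟨hL.isComplex.2 _ h {a} (by simp) (by simp), hL.isComplex.2 _ h {b} (by simp) (by simp)⟩

/-- A proper core misses a triangle along one of its edges. -/
lemma exists_triangle (hL : IsCore K L) (hK : IsDiskLike K) (hne : L ≠ K) :
    ∃ a b v, a ≠ b ∧ a ≠ v ∧ b ≠ v ∧ {a, b} ∈ L ∧ {a, b, v} ∈ K ∧ {a, b, v} ∉ L := by
  by_contra! hcon
  have hlink : ∀ a, {a} ∈ L → ∀ b, a ≠ b → {a, b} ∈ K → {a, b} ∈ L := by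
    intro a ha
    obtain ⟨c, hac, hc⟩ := hL.exists_edge a ha
    refine hK.mem_of_link_adj a {x | ({a, x} : Finset V) ∈ L} c hac hc (hL.subset hc) ?_
    intro x hx hxa y hya hxy
    by_cases h : x = y
    · exact h ▸ hx
    · exact hL.isComplex.2 _ (hcon a x y (Ne.symm hxa) (Ne.symm hya) h hx hxy) _
        (by simp [Finset.insert_subset_iff]) (by simp)
  obtain ⟨a₀, ha₀⟩ := hL.exists_vertex
  have hvert : ∀ b, {b} ∈ K → {b} ∈ L :=
    hK.mem_of_adj {x | ({x} : Finset V) ∈ L} a₀ ha₀ (hL.subset ha₀) fun a ha b hab => by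
      by_cases h : a = b
      · exact h ▸ ha
      · exact (hL.vertex_mem (hlink a ha b h hab)).2
  have hedge : ∀ a b, a ≠ b → {a, b} ∈ K → {a, b} ∈ L := fun a b hab h =>
    hlink a (hvert a (hK.isComplex.2 _ h {a} (by simp) (by simp))) b hab h
  refine hne (hL.subset.antisymm fun σ hσ => ?_)
  have h3 := hK.card_le_three hσ
  have h0 : σ.card ≠ 0 := fun h => hK.isComplex.1 σ hσ (Finset.card_eq_zero.mp h)
  obtain h | h | h : σ.card = 1 ∨ σ.card = 2 ∨ σ.card = 3 := by omega
  · obtain ⟨a, rfl⟩ := Finset.card_eq_one.mp h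
    exact hvert a hσ
  · obtain ⟨a, b, hab, rfl⟩ := Finset.card_eq_two.mp h
    exact hedge a b hab hσ
  · obtain ⟨a, b, c, hab, hac, hbc, rfl⟩ := Finset.card_eq_three.mp h
    exact hcon a b c hab hac hbc (hedge a b hab (hK.isComplex.2 _ hσ _
      (by simp [Finset.insert_subset_iff]) (by simp))) hσ

end IsCore

/-- A triangle `{a, b, v}` meeting `L` in the edge `{a, b}` and the vertex `v`, together with a
chain whose boundary outside `L` is the edge `{a, v}` and which does not contain the triangle. -/
structure IsObstruction (K L : Finset (Finset V)) (a b v : V) (r : Finset V → ZMod 2) : Prop where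
  ne_ab : a ≠ b
  ne_av : a ≠ v
  ne_bv : b ≠ v
  mem : {a, b, v} ∈ K
  notMem : {a, v} ∉ L
  faceBoundary_eq : ∀ e ∈ K, e ∉ L → e.card = 2 → faceBoundary K r e = if e = {a, v} then 1 else 0
  eq_zero : r {a, b, v} = 0

lemma subset_triple_of_card_eq_two {a b v : V} {e : Finset V} (he : e ⊆ {a, b, v})
    (hc : e.card = 2) : e = {a, b} ∨ e = {a, v} ∨ e = {b, v} := by
  obtain ⟨x, y, hxy, rfl⟩ := Finset.card_eq_two.mp hc
  have hx := he (Finset.mem_insert_self x {y})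
  have hy := he (Finset.mem_insert_of_mem (Finset.mem_singleton_self y))
  simp only [Finset.mem_insert, Finset.mem_singleton] at hx hy
  rcases hx with rfl | rfl | rfl <;> rcases hy with rfl | rfl | rfl <;>
    simp_all [Finset.pair_comm]

/-- Faces of a triangle not containing one of its edges lie in one of the other two edges. -/
lemma subset_or_subset_of_not_subset {a b v : V} {τ : Finset V} (hτ : τ ⊆ {a, b, v})
    (h : ¬ {b, v} ⊆ τ) : τ ⊆ {a, v} ∨ τ ⊆ {a, b} := by
  rw [Finset.insert_subset_iff, Finset.singleton_subset_iff, not_and_or] at h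
  refine h.imp (fun h x hx => ?_) (fun h x hx => ?_)
  · have := hτ hx
    simp only [Finset.mem_insert, Finset.mem_singleton] at this ⊢
    rcases this with rfl | rfl | rfl <;> simp_all
  · have := hτ hx
    simp only [Finset.mem_insert, Finset.mem_singleton] at this ⊢
    rcases this with rfl | rfl | rfl <;> simp_all

lemma isAttachable_of_edges_mem {K L : Finset (Finset V)} (hL : IsComplex (L : Set (Finset V)))
    {a b v : V} (hab : a ≠ b) (hav : a ≠ v) (hbv : b ≠ v) (hF : {a, b, v} ∈ K) (h1 : {a, b} ∈ L)
    (h2 : {a, v} ∈ L) (h3 : {b, v} ∉ L) : IsAttachable K L {a, b, v} {b, v} := by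
  refine ⟨hF, h3, Finset.card_eq_three.mpr ⟨a, b, v, hab, hav, hbv, rfl⟩, by simp,
    Or.inr (Finset.card_pair hbv), fun τ hτ h0 hs => ?_⟩
  rcases subset_or_subset_of_not_subset hτ hs with h | h
  exacts [hL.2 _ h2 τ h h0, hL.2 _ h1 τ h h0]

lemma isAttachable_of_vertex_notMem {K L : Finset (Finset V)}
    (hL : IsComplex (L : Set (Finset V))) {a b v : V} (hab : a ≠ b) (hav : a ≠ v) (hbv : b ≠ v)
    (hF : {a, b, v} ∈ K) (h1 : {a, b} ∈ L) (h2 : {v} ∉ L) : IsAttachable K L {a, b, v} {v} := by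
  refine ⟨hF, h2, Finset.card_eq_three.mpr ⟨a, b, v, hab, hav, hbv, rfl⟩, by simp,
    Or.inl (Finset.card_singleton v), fun τ hτ h0 hs => hL.2 _ h1 τ (fun x hx => ?_) h0⟩
  have := hτ hx
  simp only [Finset.mem_insert, Finset.mem_singleton] at this ⊢
  rcases this with rfl | rfl | rfl <;> simp_all

namespace IsCore

variable {K L : Finset (Finset V)}

/-- If no triangle can be attached, then every triangle along an edge of `L` is an obstruction. -/
lemma exists_isObstruction (hL : IsCore K L) (hK : IsDiskLike K)
    (hno : ∀ F σ, ¬ IsAttachable K L F σ) {a b v : V} (hab : a ≠ b) (hav : a ≠ v) (hbv : b ≠ v)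
    (h1 : {a, b} ∈ L) (hF : {a, b, v} ∈ K) (hFL : {a, b, v} ∉ L) :
    ∃ r, IsObstruction K L a b v r ∨ IsObstruction K L b a v r := by
  have hcard : ({a, b, v} : Finset V).card = 3 :=
    Finset.card_eq_three.mpr ⟨a, b, v, hab, hav, hbv, rfl⟩
  have hF' : ({b, a, v} : Finset V) = {a, b, v} := Finset.insert_comm b a {v}
  have hedges : ∀ e ⊆ ({a, b, v} : Finset V), e.card = 2 → e ∉ L → e = {a, v} ∨ e = {b, v} := by
    intro e he hec heL
    rcases subset_triple_of_card_eq_two he hec with rfl | h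
    exacts [absurd h1 heL, h]
  have hv : {v} ∈ L := by
    by_contra hv
    exact hno _ _ (isAttachable_of_vertex_notMem hL.isComplex hab hav hbv hF h1 hv)
  have hiff : {a, v} ∈ L ↔ {b, v} ∈ L := by
    constructor <;> intro h <;> by_contra h'
    · exact hno _ _ (isAttachable_of_edges_mem hL.isComplex hab hav hbv hF h1 h h')
    · exact hno _ _ (isAttachable_of_edges_mem hL.isComplex hab.symm hbv hav (hF'.symm ▸ hF)
        (Finset.pair_comm a b ▸ h1) h h')
  have havL : {a, v} ∉ L := by
    intro h
    have := hL.eq_zero (Pi.single {a, b, v} 1) (fun e _ heL hec => by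
      rw [faceBoundary_single hF hcard, if_neg]
      intro he
      rcases hedges e he hec heL with rfl | rfl
      exacts [heL h, heL (hiff.mp h)]) _ hF hFL hcard
    simp at this
  have hbvL : {b, v} ∉ L := fun h => havL (hiff.mpr h)
  have havF : ({a, v} : Finset V) ⊆ {a, b, v} := by simp [Finset.insert_subset_iff]
  have hbvF : ({b, v} : Finset V) ⊆ {a, b, v} := by simp
  have hne : ({a, v} : Finset V) ≠ {b, v} := fun h => by
    have : a ∈ ({b, v} : Finset V) := h ▸ by simp
    simp [hab, hav] at this
  have hchain : ∀ x, x ≠ v → {x} ∈ L → {x, v} ∈ K → ∃ r, ∀ e ∈ K, e ∉ L → e.card = 2 →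
      faceBoundary K r e = if e = {x, v} then 1 else 0 := by
    intro x hxv hx hxvK
    obtain ⟨z, hz, hzb⟩ := hL.chainJoined x v hx hv
    obtain ⟨r, hr⟩ := hK.exists_faceBoundary (z + Pi.single {x, v} 1) fun u => by
      rw [edgeBoundary_add, hzb, edgeBoundary_single_pair hxv hxvK, CharTwo.add_self_eq_zero]
    refine ⟨r, fun e he heL hec => ?_⟩
    rw [hr e he hec, Pi.add_apply, hz e heL, zero_add, Pi.single_apply]
  obtain ⟨r, hr⟩ := hchain a hav (hL.vertex_mem h1).1 (hK.isComplex.2 _ hF _ havF (by simp))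
  obtain ⟨s, hs⟩ := hchain b hbv (hL.vertex_mem h1).2 (hK.isComplex.2 _ hF _ hbvF (by simp))
  by_cases hr0 : r {a, b, v} = 0
  · exact ⟨r, Or.inl ⟨hab, hav, hbv, hF, havL, hr, hr0⟩⟩
  by_cases hs0 : s {a, b, v} = 0
  · exact ⟨s, Or.inr ⟨hab.symm, hbv, hav, hF'.symm ▸ hF, hbvL, hs, hF'.symm ▸ hs0⟩⟩
  exfalso
  have := hL.eq_zero (r + s + Pi.single {a, b, v} 1) (fun e heK heL hec => by
    rw [faceBoundary_add, faceBoundary_add, hr e heK heL hec, hs e heK heL hec,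
      faceBoundary_single hF hcard]
    by_cases he : e ⊆ {a, b, v}
    · rcases hedges e he hec heL with rfl | rfl
      · simp [hne, havF, CharTwo.add_self_eq_zero]
      · simp [hne.symm, CharTwo.add_self_eq_zero]
    · have e1 : e ≠ {a, v} := fun h => he (h ▸ havF)
      have e2 : e ≠ {b, v} := fun h => he (h ▸ hbvF)
      simp [e1, e2, he]) _ hF hFL hcard
  simp only [Pi.add_apply, zmod_two_eq_one hr0, zmod_two_eq_one hs0, Pi.single_eq_same] at this
  exact absurd this (by decide)

/-- An obstruction yields a triangle in its chain along an edge of `L`. -/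
lemma exists_triangle_of_isObstruction (hL : IsCore K L) (hK : IsDiskLike K) {a b v : V}
    {r : Finset V → ZMod 2} (h : IsObstruction K L a b v r) :
    ∃ x y w, x ≠ y ∧ x ≠ w ∧ y ≠ w ∧ {x, y} ∈ L ∧ {x, y, w} ∈ K ∧ {x, y, w} ∉ L ∧
      r {x, y, w} ≠ 0 := by
  let s : Finset V → ZMod 2 := fun t => if t ∈ L then 0 else r t
  have hs : ∀ e ∉ L, e ≠ ∅ → faceBoundary K s e = faceBoundary K r e := by
    intro e heL he0
    refine Finset.sum_congr rfl fun t ht => if_neg fun htL => ?_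
    exact heL (hL.isComplex.2 t htL e (Finset.mem_filter.mp ht).2.2 he0)
  have havK : {a, v} ∈ K := hK.isComplex.2 _ h.mem _ (by simp [Finset.insert_subset_iff]) (by simp)
  have hsav : faceBoundary K s {a, v} ≠ 0 := by
    rw [hs _ h.notMem (by simp), h.faceBoundary_eq _ havK h.notMem (Finset.card_pair h.ne_av),
      if_pos rfl]
    exact one_ne_zero
  have hsum := edgeBoundary_faceBoundary hK.isComplex s a
  obtain ⟨e, heK, hec, hne, hse⟩ : ∃ e ∈ K, e.card = 2 ∧ e ≠ {a, v} ∧ faceBoundary K s e ≠ 0 := by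
    by_contra! hcon
    rw [edgeBoundary, Finset.sum_eq_single {a, v}] at hsum
    · exact hsav hsum
    · intro e he hne
      obtain ⟨h1, h2, -⟩ := Finset.mem_filter.mp he
      exact hcon e h1 h2 hne
    · intro h'
      exact absurd (Finset.mem_filter.mpr ⟨havK, Finset.card_pair h.ne_av, by simp⟩) h'
  have heL : e ∈ L := by
    by_contra heL
    rw [hs e heL (by rintro rfl; simp at hec), h.faceBoundary_eq e heK heL hec, if_neg hne] at hse
    exact hse rfl
  obtain ⟨t, htK, htc, het, hst⟩ := exists_ne_zero_of_faceBoundary_ne_zero hse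
  obtain ⟨x, y, hxy, rfl⟩ := Finset.card_eq_two.mp hec
  obtain ⟨w, hxw, hyw, rfl⟩ := eq_insert_of_pair_subset hxy htc het
  have htL : {x, y, w} ∉ L := fun htL => hst (if_pos htL)
  exact ⟨x, y, w, hxy, hxw, hyw, heL, htK, htL, by simpa [s, htL] using hst⟩

/-- Comparison of two obstructions. -/
lemma eq_zero_of_isObstruction (hL : IsCore K L) (hK : IsDiskLike K) {a b v a' b' v' : V}
    {r r' : Finset V → ZMod 2} (h : IsObstruction K L a b v r)
    (h' : IsObstruction K L a' b' v' r') (hFL : {a', b', v'} ∉ L) (hr : r {a', b', v'} ≠ 0)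
    {t : Finset V} (htK : t ∈ K) (htL : t ∉ L) (htc : t.card = 3) (hrt : r t = 0) : r' t = 0 := by
  have hcF : ({a, b, v} : Finset V).card = 3 :=
    Finset.card_eq_three.mpr ⟨a, b, v, h.ne_ab, h.ne_av, h.ne_bv, rfl⟩
  have hcF' : ({a', b', v'} : Finset V).card = 3 :=
    Finset.card_eq_three.mpr ⟨a', b', v', h'.ne_ab, h'.ne_av, h'.ne_bv, rfl⟩
  have hsub : ({a, v} : Finset V) ⊆ {a, b, v} := by simp [Finset.insert_subset_iff]
  have hsub' : ({a', v'} : Finset V) ⊆ {a', b', v'} := by simp [Finset.insert_subset_iff]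
  have hc := Finset.card_pair h.ne_av
  have hc' := Finset.card_pair h'.ne_av
  have heK : {a, v} ∈ K := hK.isComplex.2 _ h.mem _ hsub (by simp)
  have heK' : {a', v'} ∈ K := hK.isComplex.2 _ h'.mem _ hsub' (by simp)
  have hre := h.faceBoundary_eq _ heK h.notMem hc
  have hre' := h'.faceBoundary_eq _ heK' h'.notMem hc'
  rw [if_pos rfl] at hre hre'
  have hne : ({a, v} : Finset V) ≠ {a', v'} := by
    intro heq
    have := hL.eq_zero (r + r') (fun e he heL hec => by
      rw [faceBoundary_add, h.faceBoundary_eq e he heL hec, h'.faceBoundary_eq e he heL hec, heq,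
        CharTwo.add_self_eq_zero]) _ h'.mem hFL hcF'
    rw [Pi.add_apply, h'.eq_zero, add_zero] at this
    exact hr this
  obtain ⟨G, hGK, hGc, heG, hrG⟩ := exists_ne_zero_of_faceBoundary_ne_zero (K := K) (r := r)
    (e := {a, v}) (by rw [hre]; exact one_ne_zero)
  obtain ⟨G', hGK', hGc', heG', hrG'⟩ := exists_ne_zero_of_faceBoundary_ne_zero (K := K) (r := r')
    (e := {a', v'}) (by rw [hre']; exact one_ne_zero)
  have hGF : ({a, b, v} : Finset V) ≠ G := fun hh => hrG (hh ▸ h.eq_zero)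
  have hGF' : ({a', b', v'} : Finset V) ≠ G' := fun hh => hrG' (hh ▸ h'.eq_zero)
  have key := fun q => hK.faceBoundary_eq_add q hc h.mem hcF hsub hGK hGc heG hGF
  have key' := fun q => hK.faceBoundary_eq_add q hc' h'.mem hcF' hsub' hGK' hGc' heG' hGF'
  have hr'e := h'.faceBoundary_eq _ heK h.notMem hc
  have hre'' := h.faceBoundary_eq _ heK' h'.notMem hc'
  rw [if_neg hne, key, ] at hr'e
  rw [if_neg hne.symm, key'] at hre''
  have hrG1 := zmod_two_eq_one hrG
  have hrG1' := zmod_two_eq_one hrG'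
  have hrF1 := zmod_two_eq_one hr
  have hrG'1 : r G' = 1 := by
    rw [hrF1] at hre''
    exact (CharTwo.add_eq_zero.mp hre'').symm
  have hmul : ∀ e ∈ K, e ∉ L → e.card = 2 → faceBoundary K (r * r') e =
      (if e = {a, v} then r' G else 0) + if e = {a', v'} then 1 else 0 := by
    intro e he heL hec
    by_cases h1 : e = {a, v}
    · subst h1
      rw [key, if_pos rfl, if_neg hne]
      simp only [Pi.mul_apply, h.eq_zero, hrG1]
      ring
    by_cases h2 : e = {a', v'}
    · subst h2
      rw [key', if_neg h1, if_pos rfl]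
      simp only [Pi.mul_apply, h'.eq_zero, hrG'1, hrG1']
      ring
    · rw [if_neg h1, if_neg h2, add_zero]
      refine hK.faceBoundary_mul hec ?_ ?_
      · rw [h.faceBoundary_eq e he heL hec, if_neg h1]
      · rw [h'.faceBoundary_eq e he heL hec, if_neg h2]
  by_cases hcase : r' G = 0
  · have := hL.eq_zero (r * r' + r') (fun e he heL hec => by
      rw [faceBoundary_add, hmul e he heL hec, h'.faceBoundary_eq e he heL hec, hcase]
      simp [CharTwo.add_self_eq_zero]) t htK htL htc
    simpa [hrt] using this
  · have hG'L : G' ∉ L := fun hG' => h'.notMem (hL.isComplex.2 G' hG' _ heG' (by simp))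
    have := hL.eq_zero (r + (r * r' + r')) (fun e he heL hec => by
      rw [faceBoundary_add, faceBoundary_add, hmul e he heL hec, h.faceBoundary_eq e he heL hec,
        h'.faceBoundary_eq e he heL hec, zmod_two_eq_one hcase, add_assoc,
        CharTwo.add_self_eq_zero, add_zero, CharTwo.add_self_eq_zero]) G' hGK' hG'L hGc'
    simp only [Pi.add_apply, Pi.mul_apply, hrG'1, hrG1'] at this
    exact absurd this (by decide)

/-- To a proper core one can attach a triangle. -/
lemma exists_isAttachable (hL : IsCore K L) (hK : IsDiskLike K) (hne : L ≠ K) :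
    ∃ F σ, IsAttachable K L F σ := by
  by_contra! hno
  have hobs : ∀ a b v, a ≠ b → a ≠ v → b ≠ v → {a, b} ∈ L → {a, b, v} ∈ K → {a, b, v} ∉ L →
      ∃ a' b' v' r, IsObstruction K L a' b' v' r ∧ ({a', b', v'} : Finset V) = {a, b, v} := by
    intro a b v hab hav hbv h1 h2 h3
    obtain ⟨r, h | h⟩ := hL.exists_isObstruction hK hno hab hav hbv h1 h2 h3
    exacts [⟨a, b, v, r, h, rfl⟩, ⟨b, a, v, r, h, Finset.insert_comm b a {v}⟩]
  let m : (Finset V → ZMod 2) → ℕ := fun r => {t ∈ K | (t ∉ L ∧ t.card = 3) ∧ r t ≠ 0}.card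
  have hfalse : ∀ n a b v r, IsObstruction K L a b v r → m r = n → False := by
    intro n
    induction n using Nat.strong_induction_on with
    | _ n ih =>
      intro a b v r h hn
      obtain ⟨x, y, w, hxy, hxw, hyw, h1, h2, h3, hr⟩ := hL.exists_triangle_of_isObstruction hK h
      obtain ⟨a', b', v', r', h', heq⟩ := hobs x y w hxy hxw hyw h1 h2 h3
      rw [← heq] at h2 h3 hr
      refine ih (m r') ?_ a' b' v' r' h' rfl
      rw [← hn]
      refine Finset.card_lt_card ((Finset.ssubset_iff_of_subset fun t ht => ?_).mpr
        ⟨{a', b', v'}, ?_, ?_⟩)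
      · obtain ⟨ht1, ⟨ht2, ht3⟩, ht4⟩ := Finset.mem_filter.mp ht
        refine Finset.mem_filter.mpr ⟨ht1, ⟨ht2, ht3⟩, fun hrt => ht4 ?_⟩
        exact hL.eq_zero_of_isObstruction hK h h' h3 hr ht1 ht2 ht3 hrt
      · exact Finset.mem_filter.mpr ⟨h2, ⟨h3, Finset.card_eq_three.mpr
          ⟨a', b', v', h'.ne_ab, h'.ne_av, h'.ne_bv, rfl⟩⟩, hr⟩
      · intro hmem
        exact (Finset.mem_filter.mp hmem).2.2 h'.eq_zero
  obtain ⟨a, b, v, hab, hav, hbv, h1, h2, h3⟩ := hL.exists_triangle hK hne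
  obtain ⟨a', b', v', r, h, -⟩ := hobs a b v hab hav hbv h1 h2 h3
  exact hfalse _ a' b' v' r h rfl

/-- A disk collapses to each of its cores. -/
lemma exists_collapse (hK : IsDiskLike K) (n : ℕ) : ∀ L, IsCore K L → (K \ L).card = n →
    ∃ (c : ℕ → Set (Finset V)) (m : ℕ), c 0 = K ∧ c m = L ∧
      ∀ i < m, ElemCollapseIJ (c i) (c (i + 1)) 2 0 ∨ ElemCollapseIJ (c i) (c (i + 1)) 2 1 := by
  induction n using Nat.strong_induction_on with
  | _ n ih =>
    intro L hL hn
    by_cases hne : L = K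
    · exact ⟨fun _ => K, 0, rfl, by rw [hne], fun i hi => absurd hi (Nat.not_lt_zero i)⟩
    obtain ⟨F, σ, h⟩ := hL.exists_isAttachable hK hne
    have hcore := h.isCore hK hL
    have hσ : σ ∈ attach L F := mem_attach.mpr (Or.inr ⟨h.ne_empty, h.subset⟩)
    obtain ⟨c, m, h0, hm, hc⟩ := ih (K \ attach L F).card (by
      rw [← hn]
      refine Finset.card_lt_card ((Finset.ssubset_iff_of_subset
        (Finset.sdiff_subset_sdiff subset_rfl (subset_attach L F))).mpr ⟨σ, ?_, ?_⟩)
      · exact Finset.mem_sdiff.mpr ⟨hcore.subset hσ, h.notMem⟩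
      · exact fun h' => (Finset.mem_sdiff.mp h').2 hσ) (attach L F) hcore rfl
    refine ⟨fun i => if i ≤ m then c i else L, m + 1, by simpa using h0, by simp, fun i hi => ?_⟩
    rcases Nat.lt_succ_iff_lt_or_eq.mp hi with hi | rfl
    · simpa [hi.le, Nat.succ_le_iff.mpr hi] using hc i hi
    · simpa [hm] using h.elemCollapseIJ hL.isComplex

end IsCore

/-! ### Trees in the one-skeleton -/

lemma sum_edgeBoundary_mul (K : Finset (Finset V)) (z : Finset V → ZMod 2) (g : V → ZMod 2) :
    ∑ v ∈ K.biUnion id, edgeBoundary K z v * g v =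
      ∑ e ∈ K with e.card = 2, z e * ∑ v ∈ e, g v := by
  simp only [edgeBoundary, Finset.sum_mul, Finset.mul_sum]
  refine Finset.sum_comm' fun v e => ?_
  simp only [Finset.mem_biUnion, Finset.mem_filter, id]
  exact ⟨fun h => ⟨h.2.2.2, h.2.1, h.2.2.1⟩, fun h => ⟨⟨e, h.2.1, h.1⟩, h.2.1, h.2.2, h.1⟩⟩

section Tree

variable {K T : Finset (Finset V)}

lemma chainJoined_of_reachable (hTK : T ⊆ K)
    {a b : {x : V // ({x} : Finset V) ∈ (T : Set (Finset V))}}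
    (h : (underlyingGraph (T : Set (Finset V))).Reachable a b) : ChainJoined K T a b := by
  obtain ⟨w⟩ := h
  induction w with
  | nil => exact ChainJoined.refl _
  | cons hadj _ ih => exact (ChainJoined.of_mem hadj.2 hadj.1 (hTK hadj.1)).trans ih

/-- A cycle modulo two that lives on the edges of a forest vanishes. -/
lemma eq_zero_of_edgeBoundary_eq_zero (hT : IsComplex (T : Set (Finset V)))
    (hforest : (underlyingGraph (T : Set (Finset V))).IsAcyclic) {y : Finset V → ZMod 2}
    (hy : ∀ v, edgeBoundary K y v = 0) (hyT : ∀ e ∈ K, e ∉ T → e.card = 2 → y e = 0) :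
    ∀ e ∈ K, e.card = 2 → y e = 0 := by
  intro e heK hec
  by_cases heT : e ∈ T
  swap
  · exact hyT e heK heT hec
  obtain ⟨a, b, hab, rfl⟩ := Finset.card_eq_two.mp hec
  set G := underlyingGraph (T : Set (Finset V))
  have hvert : ∀ {x e : _}, e ∈ T → x ∈ e → ({x} : Finset V) ∈ (T : Set (Finset V)) :=
    fun he hx => hT.2 _ he _ (by simpa using hx) (by simp)
  let a' : {x : V // ({x} : Finset V) ∈ (T : Set (Finset V))} :=
    ⟨a, hvert heT (Finset.mem_insert_self a {b})⟩
  let b' : {x : V // ({x} : Finset V) ∈ (T : Set (Finset V))} :=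
    ⟨b, hvert heT (Finset.mem_insert_of_mem (Finset.mem_singleton_self b))⟩
  have hadj : G.Adj a' b' := ⟨heT, hab⟩
  have hbridge := SimpleGraph.isAcyclic_iff_forall_adj_isBridge.mp hforest hadj
  rw [SimpleGraph.isBridge_iff] at hbridge
  let S : Set V := {v | ∃ h, (G.deleteEdges {s(a', b')}).Reachable a' ⟨v, h⟩}
  have haS : a ∈ S := ⟨a'.2, SimpleGraph.Reachable.refl a'⟩
  have hbS : b ∉ S := fun ⟨_, h⟩ => hbridge h
  have hstep : ∀ c d, c ≠ d → ({c, d} : Finset V) ∈ T → ({c, d} : Finset V) ≠ {a, b} →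
      c ∈ S → d ∈ S := by
    rintro c d hcd hT' hne ⟨hc, hr⟩
    refine ⟨hvert hT' (Finset.mem_insert_of_mem (Finset.mem_singleton_self d)), hr.trans
      (SimpleGraph.Adj.reachable ?_)⟩
    rw [SimpleGraph.deleteEdges_adj]
    refine ⟨⟨hT', hcd⟩, fun h => hne ?_⟩
    rw [Set.mem_singleton_iff, Sym2.eq_iff] at h
    rcases h with ⟨h1, h2⟩ | ⟨h1, h2⟩
    · rw [show c = a from congrArg Subtype.val h1, show d = b from congrArg Subtype.val h2]
    · rw [show c = b from congrArg Subtype.val h1, show d = a from congrArg Subtype.val h2,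
        Finset.pair_comm]
  have hsum := sum_edgeBoundary_mul K y (fun v => if v ∈ S then 1 else 0)
  simp only [hy, zero_mul, Finset.sum_const_zero] at hsum
  rw [Finset.sum_eq_single {a, b}] at hsum
  · simpa [Finset.sum_pair hab, haS, hbS] using hsum.symm
  · intro e he hne
    obtain ⟨heK, hec⟩ := Finset.mem_filter.mp he
    by_cases heT : e ∈ T
    · obtain ⟨c, d, hcd, rfl⟩ := Finset.card_eq_two.mp hec
      have hiff : c ∈ S ↔ d ∈ S := ⟨hstep c d hcd heT hne, hstep d c hcd.symm
        (Finset.pair_comm c d ▸ heT) (Finset.pair_comm c d ▸ hne)⟩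
      rw [Finset.sum_pair hcd, if_congr hiff rfl rfl, CharTwo.add_self_eq_zero, mul_zero]
    · rw [hyT e heK heT hec, zero_mul]
  · exact fun h => absurd (Finset.mem_filter.mpr ⟨heK, hec⟩) h

lemma IsDiskLike.isCore_of_isTree (hK : IsDiskLike K) (hTK : T ⊆ K)
    (hT : IsComplex (T : Set (Finset V)))
    (htree : (underlyingGraph (T : Set (Finset V))).IsTree)
    (hT2 : ∃ x y : V, {x} ∈ T ∧ {y} ∈ T ∧ x ≠ y) : IsCore K T := by
  obtain ⟨x, y, hx, hy, hxy⟩ := hT2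
  refine ⟨hTK, hT, ⟨x, hx⟩, fun a ha => ?_, fun a b ha hb =>
    chainJoined_of_reachable hTK (htree.connected.preconnected ⟨a, ha⟩ ⟨b, hb⟩), fun r hr =>
    fun t ht _ htc => hK.eq_zero_of_faceBoundary r (eq_zero_of_edgeBoundary_eq_zero hT
      htree.isAcyclic (edgeBoundary_faceBoundary hK.isComplex r) hr) t ht htc⟩
  obtain ⟨b, hb, hab⟩ : ∃ b, {b} ∈ T ∧ a ≠ b := by
    by_cases h : a = x
    · exact ⟨y, hy, h ▸ hxy⟩
    · exact ⟨x, hx, h⟩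
  obtain ⟨w⟩ := htree.connected.preconnected ⟨a, ha⟩ ⟨b, hb⟩
  cases w with
  | nil => exact absurd rfl hab
  | cons hadj _ => exact ⟨_, hadj.2, hadj.1⟩

end Tree

/-- Lemma 13.3. -/
theorem disk_collapses_to_tree {N : ℕ}
    (D : Geometry.SimplicialComplex ℝ (EuclideanSpace ℝ (Fin N)))
    (hfin : D.faces.Finite)
    (hdisk : IsBallSet 2 D.space)
    (T : Set (Finset (EuclideanSpace ℝ (Fin N))))
    (hTsub : T ⊆ D.faces)
    (hTcx : IsComplex T)
    (hTdim : ∀ σ ∈ T, σ.card ≤ 2)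
    (htree : (underlyingGraph T).IsTree)
    (hT2 : ∃ x y : EuclideanSpace ℝ (Fin N),
      ({x} : Finset (EuclideanSpace ℝ (Fin N))) ∈ T ∧
      ({y} : Finset (EuclideanSpace ℝ (Fin N))) ∈ T ∧ x ≠ y) :
    ∃ (c : ℕ → Set (Finset (EuclideanSpace ℝ (Fin N)))) (n : ℕ),
      c 0 = D.faces ∧ c n = T ∧
      ∀ i < n, ElemCollapseIJ (c i) (c (i + 1)) 2 0 ∨
        ElemCollapseIJ (c i) (c (i + 1)) 2 1 := by
  have hTfin := hfin.subset hTsub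
  have hcore : IsCore hfin.toFinset hTfin.toFinset := by
    refine (isDiskLike_toFinset_faces D hfin hdisk).isCore_of_isTree
      (Set.Finite.toFinset_subset_toFinset.mpr hTsub) ?_ ?_ ?_
    · rwa [hTfin.coe_toFinset]
    · rwa [hTfin.coe_toFinset]
    · simpa only [hTfin.mem_toFinset] using hT2
  obtain ⟨c, n, h0, hn, hc⟩ :=
    IsCore.exists_collapse (isDiskLike_toFinset_faces D hfin hdisk) _ _ hcore rfl
  exact ⟨c, n, by rw [h0, hfin.coe_toFinset], by rw [hn, hTfin.coe_toFinset], hc⟩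

end PaperFormal
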